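/- arXiv:1703.10953 — 3 statements merged into one kernel-verified Lean document; each statement's English description precedes it below -/
import Mathlib

section
/- For every ε > 0 there exists N₀ such that for all real N ≥ N₀ one has C(N) ≥ N^{1 − ε}. -/
open Real

/-- `countC N` is the number of integers `n` with `1 < n ≤ N` such that `n = a * b`
for some positive integers `a, b` with `a² + b²` prime. -/
noncomputable def countC (N : ℝ) : ℕ :=
  {n : ℕ | 1 < n ∧ (n : ℝ) ≤ N ∧
    ∃ a b : ℕ, 0 < a ∧ 0 < b ∧ n = a * b ∧ Nat.Prime (a ^ 2 + b ^ 2)}.ncard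

section

open Finset
open scoped ArithmeticFunction.vonMangoldt ArithmeticFunction.zeta

theorem log_factorial_eq_sum_Ioc (N : ℕ) :
    log (N.factorial) = ∑ n ∈ Ioc 0 N, log (n : ℝ) := by
  induction N with
  | zero => simp
  | succ N ih =>
    rw [Finset.sum_Ioc_succ_top (Nat.zero_le N), ← ih, Nat.factorial_succ, Nat.cast_mul,
      log_mul (by positivity) (by positivity), add_comm]

theorem log_factorial_eq_sum_vonMangoldt_mul (N : ℕ) :
    log (N.factorial) = ∑ n ∈ Ioc 0 N, Λ n * ((N / n : ℕ) : ℝ) := by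
  have key := ArithmeticFunction.sum_Ioc_mul_zeta_eq_sum Λ N
  rw [ArithmeticFunction.vonMangoldt_mul_zeta] at key
  rw [log_factorial_eq_sum_Ioc, ← key]
  rfl

/-- The lower half of Mertens' first theorem for the von Mangoldt function. -/
theorem log_sub_one_le_sum_vonMangoldt_div {N : ℕ} (hN : 1 ≤ N) :
    log N - 1 ≤ ∑ n ∈ Ioc 0 N, Λ n / n := by
  have hN' : (0 : ℝ) < N := by exact_mod_cast hN
  have hle : log (N.factorial) ≤ N * ∑ n ∈ Ioc 0 N, Λ n / n := by
    rw [log_factorial_eq_sum_vonMangoldt_mul, mul_sum]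
    refine sum_le_sum fun n _ ↦ ?_
    calc Λ n * ((N / n : ℕ) : ℝ) ≤ Λ n * (N / n : ℝ) :=
          mul_le_mul_of_nonneg_left Nat.cast_div_le ArithmeticFunction.vonMangoldt_nonneg
      _ = N * (Λ n / n) := by ring
  have hst := Stirling.le_log_factorial_stirling (Nat.one_le_iff_ne_zero.mp hN)
  have h1 : 0 ≤ log (N : ℝ) := log_natCast_nonneg N
  have h2 : 0 ≤ log (2 * π) := log_nonneg (by linarith [pi_gt_three])
  have : N * (log N - 1) ≤ N * ∑ n ∈ Ioc 0 N, Λ n / n := by linarith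
  exact le_of_mul_le_mul_left this hN'

theorem sum_vonMangoldt_Ioc_le (N : ℕ) : ∑ n ∈ Ioc 0 N, Λ n ≤ (log 4 + 4) * N := by
  simpa [Chebyshev.psi] using Chebyshev.psi_le_const_mul_self (x := N) (Nat.cast_nonneg N)

/-- The upper half of Mertens' first theorem for the von Mangoldt function. -/
theorem sum_vonMangoldt_div_le {N : ℕ} (hN : 1 ≤ N) :
    ∑ n ∈ Ioc 0 N, Λ n / n ≤ log N + (log 4 + 4) := by
  have hN' : (0 : ℝ) < N := by exact_mod_cast hN
  have hfac : log (N.factorial) ≤ N * log N := by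
    rw [← log_pow]
    exact log_le_log (by positivity) (by exact_mod_cast N.factorial_le_pow)
  have hle : N * ∑ n ∈ Ioc 0 N, Λ n / n ≤ log (N.factorial) + ∑ n ∈ Ioc 0 N, Λ n := by
    rw [log_factorial_eq_sum_vonMangoldt_mul, mul_sum, ← sum_add_distrib]
    refine sum_le_sum fun n _ ↦ ?_
    have hfloor : (N / n : ℝ) ≤ ((N / n : ℕ) : ℝ) + 1 := by
      rw [← Nat.floor_div_eq_div (K := ℝ)]
      exact (Nat.lt_floor_add_one _).le
    calc N * (Λ n / n) = Λ n * (N / n : ℝ) := by ring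
      _ ≤ Λ n * (((N / n : ℕ) : ℝ) + 1) :=
          mul_le_mul_of_nonneg_left hfloor ArithmeticFunction.vonMangoldt_nonneg
      _ = _ := by ring
  have := sum_vonMangoldt_Ioc_le N
  refine le_of_mul_le_mul_left (a := (N : ℝ)) ?_ hN'
  linarith

/-- The nontrivial Dirichlet character modulo `4`, as a real-valued function on `ℕ`. -/
def chiFour (n : ℕ) : ℝ := (ZMod.χ₄ (n : ZMod 4) : ℤ)

theorem chiFour_mul (m n : ℕ) : chiFour (m * n) = chiFour m * chiFour n := by
  rw [chiFour, Nat.cast_mul, map_mul, Int.cast_mul, chiFour, chiFour]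

theorem chiFour_eq_ite (n : ℕ) :
    chiFour n = if n % 2 = 0 then 0 else if n % 4 = 1 then 1 else -1 := by
  rw [chiFour, ZMod.χ₄_nat_eq_if_mod_four]
  split_ifs <;> simp

theorem abs_chiFour_le_one (n : ℕ) : |chiFour n| ≤ 1 := by
  rw [chiFour_eq_ite]
  split_ifs <;> simp

theorem abs_sum_chiFour_mul_le {f : ℕ → ℝ} {m : ℕ} (hf0 : ∀ n, 0 ≤ f n)
    (hf : ∀ n, m < n → f (n + 1) ≤ f n) {N : ℕ} (hmN : m ≤ N) :
    |∑ n ∈ Ioc m N, chiFour n * f n| ≤ f (m + 1) := by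
  set X : ℕ → ℝ := fun n ↦ if n % 4 = 1 ∨ n % 4 = 2 then 1 else 0 with hX
  have hX01 : ∀ n, 0 ≤ X n ∧ X n ≤ 1 := fun n ↦ by
    simp only [hX]; split_ifs <;> norm_num
  have hXs : ∀ n, X (n + 1) = X n + chiFour (n + 1) := fun n ↦ by
    simp only [hX, chiFour_eq_ite]
    split_ifs <;> first | omega | norm_num
  have key : -f (m + 1) ≤ ∑ n ∈ Ioc m N, chiFour n * f n - X N * f (N + 1) ∧
      ∑ n ∈ Ioc m N, chiFour n * f n - X N * f (N + 1) + f (N + 1) ≤ f (m + 1) := by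
    induction N, hmN using Nat.le_induction with
    | base =>
      obtain ⟨h0, h1⟩ := hX01 m
      have := hf0 (m + 1)
      simp only [Ioc_self, sum_empty]
      constructor <;> nlinarith
    | succ N hN ih =>
      rw [sum_Ioc_succ_top hN]
      have hd := hf (N + 1) (by omega)
      obtain ⟨h0, h1⟩ := hX01 (N + 1)
      have hc : chiFour (N + 1) = X (N + 1) - X N := by rw [hXs]; ring
      rw [hc]
      constructor <;> nlinarith [ih.1, ih.2]
  obtain ⟨h0, h1⟩ := hX01 N
  have := hf0 (N + 1)
  rw [abs_le]
  constructor <;> nlinarith [key.1, key.2]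

theorem abs_sum_Ioc_chiFour_div_le {m N : ℕ} (hmN : m ≤ N) :
    |∑ n ∈ Ioc m N, chiFour n / n| ≤ 1 / (m + 1 : ℝ) := by
  have := abs_sum_chiFour_mul_le (f := fun n ↦ 1 / (n : ℝ)) (m := m) (fun n ↦ by positivity)
    (fun n hn ↦ by
      have : (0 : ℝ) < n := by exact_mod_cast (Nat.zero_le m).trans_lt hn
      push_cast
      gcongr
      linarith) hmN
  simpa [div_eq_mul_inv] using this

theorem two_thirds_le_sum_chiFour_div {N : ℕ} (hN : 1 ≤ N) :
    2 / 3 ≤ ∑ n ∈ Ioc 0 N, chiFour n / n := by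
  obtain rfl | hN2 := hN.eq_or_lt
  · norm_num [chiFour_eq_ite]
  · have h := neg_le_of_abs_le (abs_sum_Ioc_chiFour_div_le (m := 2) hN2)
    have hsplit := sum_Ioc_consecutive (fun n : ℕ ↦ chiFour n / n) (Nat.zero_le 2) hN2
    have h2 : ∑ n ∈ Ioc 0 2, chiFour n / n = 1 := by
      norm_num [chiFour_eq_ite, show Ioc 0 2 = {1, 2} by rfl]
    norm_num at h
    linarith

theorem abs_sum_chiFour_mul_log_div_le (N : ℕ) :
    |∑ n ∈ Ioc 0 N, chiFour n * (log n / n)| ≤ 1 := by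
  have h2 : ∀ M ≤ 2, ∑ n ∈ Ioc 0 M, chiFour n * (log n / n) = 0 := fun M hM ↦ by
    refine sum_eq_zero fun n hn ↦ ?_
    have : n = 1 ∨ n = 2 := by rw [mem_Ioc] at hn; omega
    rcases this with rfl | rfl <;> simp [chiFour_eq_ite]
  rcases le_total N 2 with hN | hN
  · simp [h2 N hN]
  · rw [← sum_Ioc_consecutive _ (Nat.zero_le 2) hN, h2 2 le_rfl, zero_add]
    refine (abs_sum_chiFour_mul_le (f := fun n ↦ log (n : ℝ) / n) (fun n ↦ ?_) (fun n hn ↦ ?_)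
      hN).trans ?_
    · have := log_natCast_nonneg n
      positivity
    · have h3 : (3 : ℝ) ≤ n := by exact_mod_cast hn
      have he := exp_one_lt_three
      exact log_div_self_antitoneOn (Set.mem_Ici.2 (by linarith))
        (Set.mem_Ici.2 (by push_cast; linarith)) (by push_cast; linarith)
    · have := log_le_sub_one_of_pos (x := 3) (by norm_num)
      norm_num at this ⊢
      linarith

/-- Mertens' theorem for the von Mangoldt function twisted by the character modulo `4`. -/
theorem abs_sum_chiFour_mul_vonMangoldt_div_le {N : ℕ} (hN : 1 ≤ N) :
    |∑ n ∈ Ioc 0 N, chiFour n * (Λ n / n)| ≤ 3 / 2 * (1 + (log 4 + 4)) := by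
  have hN' : (0 : ℝ) < N := by exact_mod_cast hN
  let F : ArithmeticFunction ℝ := ⟨fun n ↦ chiFour n * (Λ n / n), by simp⟩
  let G : ArithmeticFunction ℝ := ⟨fun n ↦ chiFour n / n, by simp⟩
  have hFG : ∀ n, (F * G) n = chiFour n * (log n / n) := fun n ↦ by
    have hΛ : ∑ i ∈ n.divisors, Λ i = ∑ x ∈ n.divisorsAntidiagonal, Λ x.1 :=
      (Nat.sum_divisorsAntidiagonal (fun i _ ↦ Λ i)).symm
    rw [ArithmeticFunction.mul_apply, ← ArithmeticFunction.vonMangoldt_sum, hΛ, sum_div, mul_sum]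
    refine sum_congr rfl fun x hx ↦ ?_
    obtain ⟨hx, _⟩ := Nat.mem_divisorsAntidiagonal.mp hx
    simp only [F, G, ArithmeticFunction.coe_mk, ← hx, chiFour_mul, Nat.cast_mul]
    ring
  have key := ArithmeticFunction.sum_Ioc_mul_eq_sum_sum F G N
  simp only [hFG] at key
  simp only [F, G, ArithmeticFunction.coe_mk] at key
  set H := ∑ n ∈ Ioc 0 N, chiFour n / n with hH
  have herr : |(∑ n ∈ Ioc 0 N, chiFour n * (Λ n / n)) * H -
      ∑ n ∈ Ioc 0 N, chiFour n * (log n / n)| ≤ log 4 + 4 := by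
    rw [key, sum_mul, ← sum_sub_distrib]
    calc _ ≤ ∑ n ∈ Ioc 0 N, Λ n / N := by
          refine (abs_sum_le_sum_abs _ _).trans (sum_le_sum fun n hn ↦ ?_)
          have hn0 : (0 : ℝ) < n := by exact_mod_cast (mem_Ioc.mp hn).1
          have hΛ : 0 ≤ Λ n := ArithmeticFunction.vonMangoldt_nonneg
          rw [← mul_sub, hH, ← sum_Ioc_consecutive _ (Nat.zero_le (N / n)) (Nat.div_le_self N n),
            add_sub_cancel_left, abs_mul, abs_mul, abs_of_nonneg (by positivity : 0 ≤ Λ n / n)]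
          have hfloor : (N / n : ℝ) ≤ ((N / n : ℕ) : ℝ) + 1 := by
            rw [← Nat.floor_div_eq_div (K := ℝ)]
            exact (Nat.lt_floor_add_one _).le
          calc |chiFour n| * (Λ n / n) * |∑ i ∈ Ioc (N / n) N, chiFour i / i|
              ≤ 1 * (Λ n / n) * (1 / (N / n)) := by
                gcongr
                · exact abs_chiFour_le_one n
                · refine (abs_sum_Ioc_chiFour_div_le (Nat.div_le_self N n)).trans ?_
                  gcongr
            _ = Λ n / N := by field_simp
      _ ≤ _ := by
          rw [← sum_div, div_le_iff₀ hN']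
          exact sum_vonMangoldt_Ioc_le N
  have hlog := abs_sum_chiFour_mul_log_div_le N
  have hH23 := two_thirds_le_sum_chiFour_div hN
  have hprod : |∑ n ∈ Ioc 0 N, chiFour n * (Λ n / n)| * H ≤ 1 + (log 4 + 4) := by
    have habs := abs_mul (∑ n ∈ Ioc 0 N, chiFour n * (Λ n / n)) H
    rw [abs_of_nonneg (by linarith : 0 ≤ H)] at habs
    rw [← habs]
    have := abs_sub_abs_le_abs_sub ((∑ n ∈ Ioc 0 N, chiFour n * (Λ n / n)) * H)
      (∑ n ∈ Ioc 0 N, chiFour n * (log n / n))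
    linarith
  nlinarith [abs_nonneg (∑ n ∈ Ioc 0 N, chiFour n * (Λ n / n))]

/-- The primes up to `N` that are sums of two squares. -/
def primesNotThreeModFour (N : ℕ) : Finset ℕ :=
  {p ∈ Ioc 0 N | p.Prime ∧ p % 4 ≠ 3}

theorem sum_one_add_chiFour_mul_vonMangoldt_le {C : ℝ}
    (hC : ∀ x : ℝ, Chebyshev.psi x - Chebyshev.theta x ≤ C * √x) (N : ℕ) :
    ∑ n ∈ Ioc 0 N, (1 + chiFour n) * Λ n ≤
      2 * (C * √N + #(primesNotThreeModFour N) * log N) := by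
  have hpow : ∑ n ∈ Ioc 0 N with ¬ n.Prime, Λ n ≤ C * √N := by
    have := hC N
    rwa [Chebyshev.psi_sub_theta_eq_sum_not_prime, Nat.floor_natCast] at this
  calc ∑ n ∈ Ioc 0 N, (1 + chiFour n) * Λ n
      ≤ ∑ n ∈ Ioc 0 N, 2 * ((if ¬ n.Prime then Λ n else 0) +
          if n.Prime ∧ n % 4 ≠ 3 then log N else 0) := by
        refine sum_le_sum fun n hn ↦ ?_
        obtain ⟨hn0, hnN⟩ := mem_Ioc.mp hn
        have hΛ : 0 ≤ Λ n := ArithmeticFunction.vonMangoldt_nonneg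
        have hχ := (abs_le.mp (abs_chiFour_le_one n)).2
        have hlog : Λ n ≤ log N := ArithmeticFunction.vonMangoldt_le_log.trans
          (log_le_log (by exact_mod_cast hn0) (by exact_mod_cast hnN))
        by_cases hp : n.Prime
        · by_cases h3 : n % 4 = 3
          · have : chiFour n = -1 := by
              rw [chiFour_eq_ite, if_neg (by omega), if_neg (by omega)]
            simp [hp, h3, this]
          · simp only [hp, h3, not_true_eq_false, if_false, ne_eq, not_false_eq_true, and_self,
              if_true]
            nlinarith
        · simp only [hp, not_false_eq_true, if_true, false_and, if_false]
          nlinarith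
    _ = 2 * (∑ n ∈ Ioc 0 N with ¬ n.Prime, Λ n + #(primesNotThreeModFour N) * log N) := by
        rw [← mul_sum, sum_add_distrib, ← sum_filter, ← sum_filter, sum_const, nsmul_eq_mul,
          primesNotThreeModFour]
    _ ≤ _ := by gcongr

/-- A Chebyshev-type lower bound for the number of primes that are sums of two squares. -/
theorem exists_div_le_card_primesNotThreeModFour :
    ∃ T : ℕ, 0 < T ∧ ∃ C : ℝ, ∀ N : ℕ, T ≤ N →
      ((N / T : ℕ) : ℝ) ≤ 2 * (C * √N + #(primesNotThreeModFour N) * log N) := by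
  obtain ⟨C, hC⟩ := Chebyshev.psi_sub_theta_le_mul_sqrt
  set c : ℝ := log 4 + 4 with hc
  set K : ℝ := 5 + 4 * c with hK
  refine ⟨⌈exp K⌉₊, Nat.ceil_pos.mpr (exp_pos _), C, fun N hN ↦ ?_⟩
  set T := ⌈exp K⌉₊ with hT
  have hT0 : 0 < T := Nat.ceil_pos.mpr (exp_pos _)
  set M := N / T with hM
  have hM1 : 1 ≤ M := Nat.div_pos hN hT0
  have hMN : M ≤ N := Nat.div_le_self N T
  have hM0 : (0 : ℝ) < M := by exact_mod_cast hM1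
  have hlog : K + log M ≤ log N := by
    rw [← log_exp K, ← log_mul (exp_pos _).ne' hM0.ne']
    refine log_le_log (by positivity) ?_
    calc exp K * M ≤ T * M := by gcongr; exact Nat.le_ceil _
      _ ≤ N := by exact_mod_cast Nat.mul_div_le N T
  have hΛ : ∀ n, 0 ≤ (1 + chiFour n) * Λ n := fun n ↦ by
    have := (abs_le.mp (abs_chiFour_le_one n)).1
    exact mul_nonneg (by linarith) ArithmeticFunction.vonMangoldt_nonneg
  have hlow : 1 ≤ ∑ n ∈ Ioc M N, (1 + chiFour n) * Λ n / n := by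
    have hs : ∀ n : ℕ, (1 + chiFour n) * Λ n / n = Λ n / n + chiFour n * (Λ n / n) :=
      fun n ↦ by ring
    simp only [hs, sum_add_distrib]
    have h1 := sum_Ioc_consecutive (fun n ↦ Λ n / n) (Nat.zero_le M) hMN
    have h2 := sum_Ioc_consecutive (fun n ↦ chiFour n * (Λ n / n)) (Nat.zero_le M) hMN
    have h3 := log_sub_one_le_sum_vonMangoldt_div (hM1.trans hMN)
    have h4 := sum_vonMangoldt_div_le hM1
    have h5 := abs_le.mp (abs_sum_chiFour_mul_vonMangoldt_div_le (hM1.trans hMN))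
    have h6 := abs_le.mp (abs_sum_chiFour_mul_vonMangoldt_div_le hM1)
    linarith [h5.1, h6.2]
  calc (M : ℝ) ≤ M * ∑ n ∈ Ioc M N, (1 + chiFour n) * Λ n / n := by nlinarith
    _ ≤ ∑ n ∈ Ioc M N, (1 + chiFour n) * Λ n := by
        rw [mul_sum]
        refine sum_le_sum fun n hn ↦ ?_
        have hn : (M : ℝ) ≤ n := by exact_mod_cast (mem_Ioc.mp hn).1.le
        have hn0 : (0 : ℝ) < n := hM0.trans_le hn
        rw [mul_div_assoc', div_le_iff₀ hn0, mul_comm]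
        exact mul_le_mul_of_nonneg_left hn (hΛ n)
    _ ≤ ∑ n ∈ Ioc 0 N, (1 + chiFour n) * Λ n :=
        sum_le_sum_of_subset_of_nonneg (Ioc_subset_Ioc_left (Nat.zero_le M)) fun n _ _ ↦ hΛ n
    _ ≤ _ := sum_one_add_chiFour_mul_vonMangoldt_le hC N

end

section

open Finset

theorem exists_add_one_le_mul_rpow {δ : ℝ} (hδ : 0 < δ) :
    ∃ K : ℝ, 1 ≤ K ∧ ∃ P : ℕ, ∀ p : ℕ, p.Prime → ∀ k : ℕ,
      (k + 1 : ℝ) ≤ (if p < P then K else 1) * ((p ^ k : ℕ) : ℝ) ^ δ := by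
  have hlog2 : 0 < log 2 := log_pos one_lt_two
  refine ⟨max 1 (1 / (δ * log 2)), le_max_left _ _, ⌈(2 : ℝ) ^ (1 / δ)⌉₊, fun p hp k ↦ ?_⟩
  set K := max 1 (1 / (δ * log 2))
  have hpow : ((p ^ k : ℕ) : ℝ) ^ δ = ((p : ℝ) ^ δ) ^ k := by
    rw [Nat.cast_pow, ← rpow_natCast, ← rpow_natCast, ← rpow_mul (by positivity),
      ← rpow_mul (by positivity), mul_comm]
  split_ifs with hP
  · have h2 : exp (δ * log 2 * k) ≤ ((p : ℝ) ^ δ) ^ k := by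
      have : exp (δ * log 2 * k) = ((2 : ℝ) ^ δ) ^ k := by
        rw [mul_comm, exp_nat_mul, rpow_def_of_pos two_pos, mul_comm δ]
      rw [this]
      gcongr
      exact_mod_cast hp.two_le
    have h3 := add_one_le_exp (δ * log 2 * k)
    have hK1 : 1 ≤ K := le_max_left _ _
    have hK2 : 1 ≤ K * (δ * log 2) := by
      rw [← div_le_iff₀ (by positivity)]
      exact le_max_right _ _
    have hk : (0 : ℝ) ≤ k := k.cast_nonneg
    calc (k + 1 : ℝ) ≤ K * (δ * log 2 * k + 1) := by nlinarith
      _ ≤ K * ((p ^ k : ℕ) : ℝ) ^ δ := by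
        rw [hpow]
        gcongr
        exact h3.trans h2
  · have h2 : (2 : ℝ) ≤ (p : ℝ) ^ δ := by
      calc (2 : ℝ) = ((2 : ℝ) ^ (1 / δ)) ^ δ := by
            rw [← rpow_mul (by norm_num), one_div_mul_cancel hδ.ne', rpow_one]
        _ ≤ (p : ℝ) ^ δ := by
            gcongr
            exact (Nat.le_ceil _).trans (by exact_mod_cast not_lt.mp hP)
    rw [one_mul, hpow]
    calc (k + 1 : ℝ) ≤ 2 ^ k := by exact_mod_cast Nat.lt_two_pow_self
      _ ≤ _ := by gcongr

/-- The divisor bound: the number of divisors of `n` is `O(n ^ δ)` for every `δ > 0`. -/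
theorem exists_card_divisors_le_mul_rpow {δ : ℝ} (hδ : 0 < δ) :
    ∃ C : ℝ, 0 < C ∧ ∀ n : ℕ, n ≠ 0 → (#n.divisors : ℝ) ≤ C * (n : ℝ) ^ δ := by
  obtain ⟨K, hK, P, hKP⟩ := exists_add_one_le_mul_rpow hδ
  refine ⟨K ^ P, by positivity, fun n hn ↦ ?_⟩
  have hprod : ∏ p ∈ n.primeFactors, ((p ^ n.factorization p : ℕ) : ℝ) ^ δ = (n : ℝ) ^ δ := by
    rw [finsetProd_rpow _ _ fun _ _ ↦ Nat.cast_nonneg _, ← Nat.cast_prod]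
    congr 2
    exact Nat.prod_factorization_pow_eq_self hn
  have hconst : ∏ p ∈ n.primeFactors, (if p < P then K else 1) ≤ K ^ P := by
    rw [← prod_filter, prod_const]
    refine pow_le_pow_right₀ hK ?_
    calc #{p ∈ n.primeFactors | p < P} ≤ #(range P) :=
          card_le_card fun p hp ↦ mem_range.mpr (mem_filter.mp hp).2
      _ = P := card_range P
  calc (#n.divisors : ℝ) = ∏ p ∈ n.primeFactors, (n.factorization p + 1 : ℝ) := by
        rw [Nat.card_divisors hn]
        push_cast
        rfl
    _ ≤ ∏ p ∈ n.primeFactors,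
          (if p < P then K else 1) * ((p ^ n.factorization p : ℕ) : ℝ) ^ δ :=
        prod_le_prod (fun _ _ ↦ by positivity) fun p hp ↦
          hKP p (Nat.prime_of_mem_primeFactors hp) _
    _ ≤ K ^ P * (n : ℝ) ^ δ := by
        rw [prod_mul_distrib, hprod]
        gcongr

theorem card_primesNotThreeModFour_le {x : ℝ} {D : ℕ}
    (hD : ∀ n : ℕ, 0 < n → (n : ℝ) ≤ x → #n.divisors ≤ D) :
    #(primesNotThreeModFour ⌊x⌋₊) ≤ D * countC x + 1 := by
  have hrep : ∀ p : ℕ, ∃ a b : ℕ, p.Prime ∧ p % 4 ≠ 3 → a ^ 2 + b ^ 2 = p := fun p ↦ by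
    by_cases hp : p.Prime ∧ p % 4 ≠ 3
    · have := Fact.mk hp.1
      obtain ⟨a, b, h⟩ := Nat.Prime.sq_add_sq hp.2
      exact ⟨a, b, fun _ ↦ h⟩
    · exact ⟨0, 0, fun h ↦ absurd h hp⟩
  choose a b hab using hrep
  set A := (primesNotThreeModFour ⌊x⌋₊).erase 2 with hA
  have hmem : ∀ p ∈ A, p ≠ 2 ∧ p.Prime ∧ (p : ℝ) ≤ x ∧ a p ^ 2 + b p ^ 2 = p := fun p hp ↦ by
    simp only [hA, primesNotThreeModFour, mem_erase, mem_filter, mem_Ioc] at hp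
    exact ⟨hp.1, hp.2.2.1, (Nat.le_floor_iff' hp.2.1.1.ne').mp hp.2.1.2, hab p hp.2.2⟩
  have hpos : ∀ p ∈ A, 0 < a p ∧ 0 < b p := fun p hp ↦ by
    obtain ⟨_, hpp, _, h⟩ := hmem p hp
    refine ⟨Nat.pos_of_ne_zero fun h0 ↦ ?_, Nat.pos_of_ne_zero fun h0 ↦ ?_⟩
    · have hsq : b p ^ 2 = p := by simpa [h0] using h
      exact Nat.Prime.not_prime_pow le_rfl (hsq.symm ▸ hpp : (b p ^ 2).Prime)
    · have hsq : a p ^ 2 = p := by simpa [h0] using h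
      exact Nat.Prime.not_prime_pow le_rfl (hsq.symm ▸ hpp : (a p ^ 2).Prime)
  have hle : ∀ p ∈ A, ((a p * b p : ℕ) : ℝ) ≤ x := fun p hp ↦ by
    obtain ⟨_, _, hpx, h⟩ := hmem p hp
    refine le_trans ?_ hpx
    have : a p * b p ≤ p := by nlinarith [two_mul_le_add_sq (a p) (b p)]
    exact_mod_cast this
  have hcard : #A ≤ D * #(A.image fun p ↦ a p * b p) := by
    refine card_le_mul_card_image _ _ fun n hn ↦ ?_
    obtain ⟨q, hq, rfl⟩ := mem_image.mp hn
    have hq0 : 0 < a q * b q := Nat.mul_pos (hpos q hq).1 (hpos q hq).2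
    refine le_trans (card_le_card_of_injOn a (fun p hp ↦ ?_) fun p hp r hr hpr ↦ ?_)
      (hD _ hq0 (hle q hq))
    · obtain ⟨_, hpq⟩ := mem_filter.mp hp
      exact Nat.mem_divisors.mpr ⟨⟨b p, hpq.symm⟩, hq0.ne'⟩
    · obtain ⟨hpA, hpq⟩ := mem_filter.mp hp
      obtain ⟨hrA, hrq⟩ := mem_filter.mp hr
      have hb : b p = b r :=
        Nat.eq_of_mul_eq_mul_left (hpos p hpA).1 (by rw [hpq, hpr, hrq])
      rw [← (hmem p hpA).2.2.2, ← (hmem r hrA).2.2.2, hpr, hb]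
  have himage : #(A.image fun p ↦ a p * b p) ≤ countC x := by
    rw [countC, ← Set.ncard_coe_finset]
    refine Set.ncard_le_ncard (fun n hn ↦ ?_) ?_
    · obtain ⟨p, hp, rfl⟩ := mem_image.mp (mem_coe.mp hn)
      obtain ⟨hp2, hpp, _, h⟩ := hmem p hp
      obtain ⟨ha, hb⟩ := hpos p hp
      refine ⟨lt_of_le_of_ne (Nat.mul_pos ha hb) fun h1 ↦ hp2 ?_, hle p hp, a p, b p, ha, hb, rfl,
        h.symm ▸ hpp⟩
      obtain ⟨ha1, hb1⟩ := mul_eq_one.mp h1.symm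
      simpa [ha1, hb1] using h.symm
    · exact (Set.finite_Iic ⌊x⌋₊).subset fun n hn ↦ Nat.le_floor hn.2.1
  calc #(primesNotThreeModFour ⌊x⌋₊) ≤ #A + 1 := by
        rw [← Nat.sub_le_iff_le_add]
        exact pred_card_le_card_erase
    _ ≤ D * countC x + 1 := by gcongr; exact hcard.trans (by gcongr)

end

open Filter Asymptotics in
theorem isLittleO_sqrt_add_rpow_mul_log {ε : ℝ} (hε : 0 < ε) (C D : ℝ) :
    (fun x : ℝ ↦ 2 * (C * √x + (D * x ^ (1 - ε / 2) + 1) * log x)) =o[atTop]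
      fun x : ℝ ↦ x := by
  have hsqrt : (fun x : ℝ ↦ √x) =o[atTop] fun x : ℝ ↦ x := by
    have h1 : (fun _ : ℝ ↦ (1 : ℝ)) =o[atTop] fun x : ℝ ↦ √x :=
      (isLittleO_const_left_of_ne one_ne_zero).mpr
        (tendsto_norm_atTop_atTop.comp tendsto_sqrt_atTop)
    refine ((isBigO_refl (fun x : ℝ ↦ √x) atTop).mul_isLittleO h1).congr' (by simp) ?_
    filter_upwards [eventually_ge_atTop 0] with x hx using mul_self_sqrt hx
  have hmul : (fun x : ℝ ↦ x ^ (1 - ε / 2) * log x) =o[atTop] fun x : ℝ ↦ x := by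
    refine ((isBigO_refl (fun x : ℝ ↦ x ^ (1 - ε / 2)) atTop).mul_isLittleO
      (isLittleO_log_rpow_atTop (half_pos hε))).congr' .rfl ?_
    filter_upwards [eventually_gt_atTop 0] with x hx
    rw [← rpow_add hx, sub_add_cancel, rpow_one]
  refine ((((hsqrt.const_mul_left C).add (hmul.const_mul_left D)).add
    isLittleO_log_id_atTop).const_mul_left 2).congr_left fun x ↦ ?_
  ring

theorem stmt_5 (ε : ℝ) (hε : 0 < ε) :
    ∃ N₀ : ℝ, ∀ N : ℝ, N₀ ≤ N → N ^ (1 - ε) ≤ (countC N : ℝ) := by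
  obtain ⟨T, hT0, C, hC⟩ := exists_div_le_card_primesNotThreeModFour
  obtain ⟨D, hD0, hD⟩ := exists_card_divisors_le_mul_rpow (half_pos hε)
  have hT0' : (0 : ℝ) < T := by exact_mod_cast hT0
  have hT1 : (1 : ℝ) ≤ T := by exact_mod_cast hT0
  obtain ⟨N₁, hN₁⟩ := Filter.eventually_atTop.mp
    ((isLittleO_sqrt_add_rpow_mul_log hε |C| D).bound (c := 1 / (8 * T)) (by positivity))
  refine ⟨max N₁ (4 * T), fun x hx ↦ ?_⟩
  have hxT : 4 * T ≤ x := (le_max_right _ _).trans hx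
  have hx0 : 0 < x := by linarith
  have hlog : 0 ≤ log x := log_nonneg (by linarith)
  by_contra! hlt
  have hsmall := (le_abs_self _).trans (hN₁ x ((le_max_left _ _).trans hx))
  rw [norm_of_nonneg hx0.le] at hsmall
  have hfloor : x - 1 < ⌊x⌋₊ := Nat.sub_one_lt_floor x
  have hfloor' : (⌊x⌋₊ : ℝ) ≤ x := Nat.floor_le hx0.le
  have hTfloor : T ≤ ⌊x⌋₊ := Nat.le_floor (by linarith)
  have hfloor0 : (0 : ℝ) < ⌊x⌋₊ := by exact_mod_cast hT0.trans_le hTfloor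
  have hdiv : x / (4 * T) < ((⌊x⌋₊ / T : ℕ) : ℝ) := by
    have h1 : ((⌊x⌋₊ / T : ℕ) : ℝ) > ⌊x⌋₊ / T - 1 := by
      rw [← Nat.floor_div_eq_div (K := ℝ)]
      exact Nat.sub_one_lt_floor _
    refine lt_of_le_of_lt ?_ h1
    rw [div_le_iff₀ (by positivity), sub_mul, show (⌊x⌋₊ / T : ℝ) * (4 * T) = 4 * ⌊x⌋₊ by
      field_simp]
    linarith
  have hcard : ((primesNotThreeModFour ⌊x⌋₊).card : ℝ) ≤ D * x ^ (1 - ε / 2) + 1 := by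
    have h1 := card_primesNotThreeModFour_le (x := x) (D := ⌊D * x ^ (ε / 2)⌋₊) fun n hn hnx ↦
      Nat.le_floor ((hD n hn.ne').trans (by gcongr))
    calc ((primesNotThreeModFour ⌊x⌋₊).card : ℝ)
        ≤ (⌊D * x ^ (ε / 2)⌋₊ : ℝ) * countC x + 1 := by exact_mod_cast h1
      _ ≤ D * x ^ (ε / 2) * x ^ (1 - ε) + 1 := by
          gcongr
          exact Nat.floor_le (by positivity)
      _ = D * x ^ (1 - ε / 2) + 1 := by
          rw [mul_assoc, ← rpow_add hx0]
          ring_nf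
  have hbound : x / (4 * T) < x / (8 * T) :=
    calc x / (4 * T) < ((⌊x⌋₊ / T : ℕ) : ℝ) := hdiv
      _ ≤ 2 * (C * √⌊x⌋₊ + (primesNotThreeModFour ⌊x⌋₊).card * log ⌊x⌋₊) := hC _ hTfloor
      _ ≤ 2 * (|C| * √x + (D * x ^ (1 - ε / 2) + 1) * log x) := by
          have := log_le_log hfloor0 hfloor'
          gcongr
          exact le_abs_self C
      _ ≤ 1 / (8 * T) * x := hsmall
      _ = x / (8 * T) := by ring
  have : x / (8 * T) ≤ x / (4 * T) := by gcongr; norm_num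
  linarith
end

section
/- Fix a real number α with 1 < α < 2. There exists a constant C > 0 such that for all real N ≥ 16, the number of positive integers n ≤ N with ω(n) > α log log N is at most C · N / (log N)^{1 − α + α log α}. -/
open Real

section CardDistinctFactors

open ArithmeticFunction hiding log id
open scoped ArithmeticFunction.omega

/-- For `s > 1`, the Dirichlet series of `1` at `s` is at most `1 + 1 / (s - 1)`. -/
theorem tsum_rpow_neg_le {s : ℝ} (hs : 1 < s) :
    ∑' n : ℕ, (n : ℝ) ^ (-s) ≤ 1 + 1 / (s - 1) := by
  have hsum : Summable fun n : ℕ => (n : ℝ) ^ (-s) := Real.summable_nat_rpow.2 (by linarith)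
  rw [hsum.tsum_eq_zero_add]
  have h0 : (((0 : ℕ) : ℝ)) ^ (-s) = 0 := by
    rw [Nat.cast_zero, Real.zero_rpow (by linarith)]
  have h1 : ∑' n : ℕ, (((n + 1 : ℕ) : ℝ)) ^ (-s) = ∑' n : ℕ, 1 / ((n : ℝ) + 1) ^ s := by
    refine tsum_congr fun n => ?_
    rw [Real.rpow_neg (by positivity), one_div]
    push_cast
    rfl
  have h2 := ZetaAsymptotics.zeta_limit_aux1 hs
  have h3 : 0 ≤ ZetaAsymptotics.termTSum s :=
    tsum_nonneg fun n => ZetaAsymptotics.term_nonneg _ _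
  have h4 : 0 ≤ s * ZetaAsymptotics.termTSum s := mul_nonneg (by linarith) h3
  rw [h0, h1]
  linarith

/-- The completely multiplicative function `n ↦ n ^ (-s)`. -/
noncomputable def rpowNegHom {s : ℝ} (hs : s ≠ 0) : ℕ →*₀ ℝ where
  toFun n := (n : ℝ) ^ (-s)
  map_zero' := by simp [Real.zero_rpow (neg_ne_zero.2 hs)]
  map_one' := by simp
  map_mul' m n := by
    push_cast
    exact Real.mul_rpow (Nat.cast_nonneg _) (Nat.cast_nonneg _)

/-- The Euler product of `ζ(s)` over the primes below `M` is at most `1 + 1 / (s - 1)`. -/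
theorem prod_primesBelow_one_sub_rpow_neg_inv_le {s : ℝ} (hs : 1 < s) (M : ℕ) :
    ∏ p ∈ M.primesBelow, (1 - (p : ℝ) ^ (-s))⁻¹ ≤ 1 + 1 / (s - 1) := by
  have hsum : Summable fun n : ℕ => (n : ℝ) ^ (-s) := Real.summable_nat_rpow.2 (by linarith)
  have h := EulerProduct.prod_primesBelow_geometric_eq_tsum_smoothNumbers
    (f := (rpowNegHom (s := s) (by linarith) : ℕ →* ℝ)) hsum M
  change ∏ p ∈ M.primesBelow, (1 - (p : ℝ) ^ (-s))⁻¹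
    = ∑' m : M.smoothNumbers, ((m : ℕ) : ℝ) ^ (-s) at h
  rw [h]
  exact (Summable.tsum_subtype_le _ _ (fun n => Real.rpow_nonneg (Nat.cast_nonneg n) _) hsum).trans
    (tsum_rpow_neg_le hs)

/-- Partial sums of `α ^ ω(n) / n ^ s` are bounded by `(1 + 1 / (s - 1)) ^ α`. -/
theorem sum_pow_cardDistinctFactors_mul_rpow_neg_le {α s : ℝ} (hα : 1 ≤ α) (hs : 1 < s) (M : ℕ) :
    ∑ n ∈ Finset.Ioc 0 M, α ^ ω n * (n : ℝ) ^ (-s) ≤ (1 + 1 / (s - 1)) ^ α := by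
  have hα0 : 0 < α := by linarith
  set f : ℕ → ℝ := fun n => α ^ ω n * (n : ℝ) ^ (-s) with hf
  have hf0 : ∀ n, 0 ≤ f n := fun n => by positivity
  have hf1 : f 1 = 1 := by simp [hf]
  have hmul : ∀ {m n : ℕ}, m.Coprime n → f (m * n) = f m * f n := by
    intro m n h
    simp only [hf]
    rw [cardDistinctFactors_mul h, pow_add, Nat.cast_mul,
      Real.mul_rpow (Nat.cast_nonneg _) (Nat.cast_nonneg _)]
    ring
  have hx : ∀ {p : ℕ}, p.Prime → 0 < (p : ℝ) ^ (-s) ∧ (p : ℝ) ^ (-s) < 1 := by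
    intro p hp
    have hp1 : (1 : ℝ) < p := by exact_mod_cast hp.one_lt
    exact ⟨by positivity, Real.rpow_lt_one_of_one_lt_of_neg hp1 (by linarith)⟩
  have hpow : ∀ {p : ℕ}, p.Prime → ∀ e : ℕ,
      f (p ^ (e + 1)) = α * (p : ℝ) ^ (-s) * ((p : ℝ) ^ (-s)) ^ e := by
    intro p hp e
    simp only [hf]
    rw [cardDistinctFactors_apply_prime_pow hp (Nat.succ_ne_zero e), pow_one, Nat.cast_pow,
      ← Real.rpow_natCast_mul (Nat.cast_nonneg _), mul_comm _ (-s),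
      Real.rpow_mul_natCast (Nat.cast_nonneg _), pow_succ]
    ring
  have hlocal : ∀ {p : ℕ}, p.Prime →
      HasSum (fun e => f (p ^ e)) (1 + α * ((1 - (p : ℝ) ^ (-s))⁻¹ - 1)) := by
    intro p hp
    obtain ⟨h0, h1⟩ := hx hp
    have h := (hasSum_geometric_of_lt_one h0.le h1).mul_left (α * (p : ℝ) ^ (-s))
    simp_rw [← hpow hp] at h
    have h' := (hasSum_nat_add_iff (f := fun e => f (p ^ e)) 1).1 h
    convert! h' using 1
    have : 1 - (p : ℝ) ^ (-s) ≠ 0 := by linarith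
    simp only [Finset.sum_range_one, pow_zero, hf1]
    field_simp
    ring
  obtain ⟨-, hE⟩ := EulerProduct.summable_and_hasSum_smoothNumbers_prod_primesBelow_tsum
    hf1 hmul (fun hp => (hlocal hp).summable.norm) (M + 1)
  have hsumle : ∑ n ∈ Finset.Ioc 0 M, f n ≤ ∏ p ∈ (M + 1).primesBelow, ∑' e : ℕ, f (p ^ e) := by
    have hE' := (hasSum_subtype_iff_indicator (f := f)).1 hE
    refine le_trans (Finset.sum_le_sum fun n hn => ?_)
      (sum_le_hasSum (Finset.Ioc 0 M) (fun n _ => Set.indicator_nonneg (fun n _ => hf0 n) n) hE')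
    rw [Finset.mem_Ioc] at hn
    rw [Set.indicator_of_mem (Nat.mem_smoothNumbers_of_lt hn.1 (by omega))]
  refine hsumle.trans ?_
  have hinv : ∀ p ∈ (M + 1).primesBelow, 0 ≤ (1 - (p : ℝ) ^ (-s))⁻¹ := fun p hp => by
    have := (hx (Nat.prime_of_mem_primesBelow hp)).2
    exact inv_nonneg.2 (by linarith)
  calc ∏ p ∈ (M + 1).primesBelow, ∑' e : ℕ, f (p ^ e)
      ≤ ∏ p ∈ (M + 1).primesBelow, ((1 - (p : ℝ) ^ (-s))⁻¹) ^ α := by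
        refine Finset.prod_le_prod (fun p _ => tsum_nonneg fun e => hf0 _) fun p hp => ?_
        rw [(hlocal (Nat.prime_of_mem_primesBelow hp)).tsum_eq]
        have := one_add_mul_self_le_rpow_one_add
          (s := (1 - (p : ℝ) ^ (-s))⁻¹ - 1) (by linarith [hinv p hp]) hα
        rwa [add_sub_cancel] at this
    _ = (∏ p ∈ (M + 1).primesBelow, (1 - (p : ℝ) ^ (-s))⁻¹) ^ α :=
        Real.finsetProd_rpow _ _ hinv _
    _ ≤ _ := Real.rpow_le_rpow (Finset.prod_nonneg hinv)
        (prod_primesBelow_one_sub_rpow_neg_inv_le hs _) hα0.le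

/-- `∑_{n ≤ N} α ^ ω(n) / n ≪ (log N) ^ α`. -/
theorem sum_pow_cardDistinctFactors_div_le {α N : ℝ} (hα : 1 ≤ α) (hN : 1 ≤ log N) :
    ∑ n ∈ Finset.Ioc 0 ⌊N⌋₊, α ^ ω n / n ≤ exp 1 * (2 * log N) ^ α := by
  have hL : 0 < log N := by linarith
  have h := sum_pow_cardDistinctFactors_mul_rpow_neg_le hα
    (s := 1 + 1 / log N) (by simpa using hL) ⌊N⌋₊
  have h2 : (1 + 1 / (1 + 1 / log N - 1)) ^ α ≤ (2 * log N) ^ α := by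
    rw [add_sub_cancel_left, one_div_one_div]
    exact Real.rpow_le_rpow (by linarith) (by linarith) (by linarith)
  refine le_trans ?_ (mul_le_mul_of_nonneg_left (h.trans h2) (exp_pos 1).le)
  rw [Finset.mul_sum]
  refine Finset.sum_le_sum fun n hn => ?_
  rw [Finset.mem_Ioc] at hn
  have hn0 : (0 : ℝ) < n := by exact_mod_cast hn.1
  have hnN : (n : ℝ) ≤ N := (Nat.le_floor_iff' hn.1.ne').1 hn.2
  have hexp : (n : ℝ)⁻¹ ≤ exp 1 * (n : ℝ) ^ (-(1 + 1 / log N)) := by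
    rw [Real.rpow_def_of_pos hn0, ← Real.exp_add]
    nth_rewrite 1 [← Real.exp_log hn0]
    rw [← Real.exp_neg, Real.exp_le_exp]
    have : log n / log N ≤ 1 := (div_le_one hL).2 (Real.log_le_log hn0 hnN)
    have e : log n * -(1 + 1 / log N) = - log n - log n / log N := by ring
    rw [e]
    linarith
  have hp : (0 : ℝ) ≤ α ^ ω n := by positivity
  calc α ^ ω n / n = α ^ ω n * (n : ℝ)⁻¹ := div_eq_mul_inv _ _
    _ ≤ α ^ ω n * (exp 1 * (n : ℝ) ^ (-(1 + 1 / log N))) := mul_le_mul_of_nonneg_left hexp hp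
    _ = _ := by ring

/-- The arithmetic function `n ↦ α ^ ω(n)`, set to `0` at `0`. -/
noncomputable def powCardDistinctFactors (α : ℝ) : ArithmeticFunction ℝ :=
  ⟨fun n => if n = 0 then 0 else α ^ ω n, by simp⟩

theorem powCardDistinctFactors_apply {α : ℝ} {n : ℕ} (hn : n ≠ 0) :
    powCardDistinctFactors α n = α ^ ω n := by
  simp [powCardDistinctFactors, hn]

theorem cardDistinctFactors_mul_le (m n : ℕ) : ω (m * n) ≤ ω m + ω n := by
  rcases eq_or_ne m 0 with rfl | hm
  · simp
  rcases eq_or_ne n 0 with rfl | hn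
  · simp
  change (m * n).primeFactors.card ≤ m.primeFactors.card + n.primeFactors.card
  rw [Nat.primeFactors_mul hm hn]
  exact Finset.card_union_le _ _

theorem pow_cardDistinctFactors_mul_log_le {α : ℝ} (hα : 1 ≤ α) {n : ℕ} (hn : n ≠ 0) :
    α ^ ω n * log n ≤ α * (powCardDistinctFactors α * Λ) n := by
  rw [← vonMangoldt_sum, mul_apply, Finset.mul_sum, Finset.mul_sum,
    ← Nat.sum_divisorsAntidiagonal' (fun _ i => α ^ ω n * Λ i)]
  refine Finset.sum_le_sum fun x hx => ?_
  obtain ⟨hxn, -⟩ := Nat.mem_divisorsAntidiagonal.1 hx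
  have hx1 : x.1 ≠ 0 := by rintro h; simp [h] at hxn; omega
  rw [powCardDistinctFactors_apply hx1, ← mul_assoc]
  by_cases hΛ : Λ x.2 = 0
  · simp [hΛ]
  refine mul_le_mul_of_nonneg_right ?_ vonMangoldt_nonneg
  rw [← pow_succ']
  refine pow_le_pow_right₀ hα ?_
  rw [← hxn]
  have := cardDistinctFactors_mul_le x.1 x.2
  rwa [cardDistinctFactors_eq_one_iff.2 (vonMangoldt_ne_zero_iff.1 hΛ)] at this

theorem sum_pow_cardDistinctFactors_mul_log_le {α : ℝ} (hα : 1 ≤ α) (M : ℕ) :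
    ∑ n ∈ Finset.Ioc 0 M, α ^ ω n * log n
      ≤ α * ((log 4 + 4) * M * ∑ n ∈ Finset.Ioc 0 M, α ^ ω n / n) := by
  calc ∑ n ∈ Finset.Ioc 0 M, α ^ ω n * log n
      ≤ ∑ n ∈ Finset.Ioc 0 M, α * (powCardDistinctFactors α * Λ) n :=
        Finset.sum_le_sum fun n hn =>
          pow_cardDistinctFactors_mul_log_le hα (Finset.mem_Ioc.1 hn).1.ne'
    _ = α * ∑ n ∈ Finset.Ioc 0 M,
          powCardDistinctFactors α n * ∑ m ∈ Finset.Ioc 0 (M / n), Λ m := by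
        rw [← Finset.mul_sum, sum_Ioc_mul_eq_sum_sum]
    _ ≤ _ := by
        refine mul_le_mul_of_nonneg_left ?_ (by linarith)
        rw [Finset.mul_sum]
        refine Finset.sum_le_sum fun n hn => ?_
        have hn0 := (Finset.mem_Ioc.1 hn).1
        have hψ : ∑ m ∈ Finset.Ioc 0 (M / n), Λ m ≤ (log 4 + 4) * ((M : ℝ) / n) := by
          have h := Chebyshev.psi_le_const_mul_self (x := (M : ℝ) / n) (by positivity)
          rwa [Chebyshev.psi, Nat.floor_div_eq_div] at h
        rw [powCardDistinctFactors_apply hn0.ne']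
        refine (mul_le_mul_of_nonneg_left hψ (by positivity)).trans (le_of_eq ?_)
        ring

/-- `∑_{n ≤ N} α ^ ω(n) ≪ N (log N) ^ (α - 1)`, multiplied through by `log N`. -/
theorem sum_pow_cardDistinctFactors_mul_log_self_le {α N : ℝ} (hα : 1 ≤ α) (hN0 : 0 < N)
    (hN : 1 ≤ log N) :
    (∑ n ∈ Finset.Ioc 0 ⌊N⌋₊, α ^ ω n) * log N
      ≤ (1 + α * (log 4 + 4)) * N * (exp 1 * (2 * log N) ^ α) := by
  set T := ∑ n ∈ Finset.Ioc 0 ⌊N⌋₊, α ^ ω n / (n : ℝ) with hT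
  have hT0 : 0 ≤ T := Finset.sum_nonneg fun n _ => by positivity
  have hlog4 : 0 < log 4 := Real.log_pos (by norm_num)
  have h1 : ∑ n ∈ Finset.Ioc 0 ⌊N⌋₊, α ^ ω n * (log N - log n) ≤ N * T := by
    rw [hT, Finset.mul_sum]
    refine Finset.sum_le_sum fun n hn => ?_
    have hn0 : (0 : ℝ) < n := by exact_mod_cast (Finset.mem_Ioc.1 hn).1
    rw [← Real.log_div hN0.ne' hn0.ne']
    have h := Real.log_le_sub_one_of_pos (div_pos hN0 hn0)
    refine (mul_le_mul_of_nonneg_left (show log (N / n) ≤ N / n by linarith)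
      (by positivity)).trans (le_of_eq ?_)
    ring
  have h2 := sum_pow_cardDistinctFactors_mul_log_le hα ⌊N⌋₊
  rw [← hT] at h2
  have h3 : (log 4 + 4) * (⌊N⌋₊ : ℝ) * T ≤ (log 4 + 4) * N * T := by
    have := Nat.floor_le hN0.le
    gcongr
  have h4 := mul_le_mul_of_nonneg_left h3 (show 0 ≤ α by linarith)
  have hsplit : (∑ n ∈ Finset.Ioc 0 ⌊N⌋₊, α ^ ω n) * log N
      = ∑ n ∈ Finset.Ioc 0 ⌊N⌋₊, α ^ ω n * (log N - log n)
        + ∑ n ∈ Finset.Ioc 0 ⌊N⌋₊, α ^ ω n * log n := by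
    rw [← Finset.sum_add_distrib, Finset.sum_mul]
    exact Finset.sum_congr rfl fun n _ => by ring
  have h5 : (1 + α * (log 4 + 4)) * N * T
      ≤ (1 + α * (log 4 + 4)) * N * (exp 1 * (2 * log N) ^ α) :=
    mul_le_mul_of_nonneg_left (sum_pow_cardDistinctFactors_div_le hα hN) (by positivity)
  linarith

/-- The Rankin bound: each `n` with `ω(n) > α log log N` contributes at least
`(log N) ^ (α log α)` to `∑ α ^ ω(n)`. -/
theorem ncard_mul_rpow_le_sum_pow_cardDistinctFactors {α N : ℝ} (hα : 1 ≤ α) (hN0 : 0 ≤ N)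
    (hN : 0 < log N) :
    ({n : ℕ | 0 < n ∧ (n : ℝ) ≤ N ∧
        α * log (log N) < (n.primeFactors.card : ℝ)}.ncard : ℝ) * log N ^ (α * log α)
      ≤ ∑ n ∈ Finset.Ioc 0 ⌊N⌋₊, α ^ ω n := by
  have hα0 : 0 < α := by linarith
  classical
  have hset : {n : ℕ | 0 < n ∧ (n : ℝ) ≤ N ∧ α * log (log N) < (n.primeFactors.card : ℝ)}
      = ↑((Finset.Ioc 0 ⌊N⌋₊).filter fun n => α * log (log N) < (n.primeFactors.card : ℝ)) := by
    ext n
    simp only [Set.mem_ofPred_eq, Finset.coe_filter, Finset.mem_Ioc, Nat.le_floor_iff hN0,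
      and_assoc]
  rw [hset, Set.ncard_coe_finset, ← nsmul_eq_mul]
  refine (Finset.card_nsmul_le_sum _ (fun n => α ^ ω n) _ fun n hn => ?_).trans
    (Finset.sum_le_sum_of_subset_of_nonneg (Finset.filter_subset _ _)
      fun n _ _ => by positivity)
  have hn' : α * log (log N) ≤ (ω n : ℝ) := (Finset.mem_filter.1 hn).2.le
  have hpow : log N ^ (α * log α) = α ^ (α * log (log N)) := by
    rw [Real.rpow_def_of_pos hN, Real.rpow_def_of_pos hα0]
    ring_nf
  rw [hpow, ← Real.rpow_natCast α (ω n)]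
  exact Real.rpow_le_rpow_of_exponent_le hα hn'

end CardDistinctFactors

theorem stmt_6 (α : ℝ) (hα1 : 1 < α) (hα2 : α < 2) :
    ∃ C : ℝ, 0 < C ∧ ∀ N : ℝ, 16 ≤ N →
      ({n : ℕ | 0 < n ∧ (n : ℝ) ≤ N ∧
          α * Real.log (Real.log N) < (n.primeFactors.card : ℝ)}.ncard : ℝ)
        ≤ C * N / Real.log N ^ (1 - α + α * Real.log α) := by
  have hlog4 : 0 < log 4 := Real.log_pos (by norm_num)
  refine ⟨(1 + α * (log 4 + 4)) * (exp 1 * 2 ^ α), by positivity, fun N hN => ?_⟩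
  have hN0 : 0 < N := by linarith
  have hL1 : 1 ≤ log N := by
    rw [Real.le_log_iff_exp_le hN0]
    linarith [Real.exp_one_lt_d9]
  have hL : 0 < log N := by linarith
  have h1 := ncard_mul_rpow_le_sum_pow_cardDistinctFactors hα1.le hN0.le hL
  have h2 := sum_pow_cardDistinctFactors_mul_log_self_le hα1.le hN0 hL1
  have hLα : 0 < log N ^ α := Real.rpow_pos_of_pos hL α
  have hLβ : 0 < log N ^ (α * log α) := Real.rpow_pos_of_pos hL _
  rw [Real.rpow_add hL, Real.rpow_sub hL, Real.rpow_one, le_div_iff₀ (by positivity)]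
  rw [Real.mul_rpow zero_le_two hL.le] at h2
  have h3 := (mul_le_mul_of_nonneg_right h1 hL.le).trans h2
  rw [div_mul_eq_mul_div, ← mul_div_assoc, div_le_iff₀ hLα]
  linarith
end

section
/- There exist constants C > 0 and K ≥ 0 such that for all real N ≥ 16 and all positive integers a, b, the number of primes ℓ with N^{1/log log N} < ℓ ≤ N/(ab) such that a² + b²ℓ² is prime is at most C · N · (log log N)^K / (a · b · (log N)²). -/
open Real

namespace BoundingSieve

open Finset Nat
open scoped ArithmeticFunction.Moebius

variable {s : BoundingSieve}

theorem sum_moebius_of_dvd_of_dvd {l m : ℕ} (hm : Squarefree m) (hl : l ∣ m) :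
    ∑ d ∈ m.divisors, (if l ∣ d then (μ d : ℝ) else 0) = if m = l then (μ l : ℝ) else 0 := by
  obtain ⟨k, rfl⟩ := hl
  have hlk : Squarefree l ∧ Squarefree k := ⟨hm.of_mul_left, hm.of_mul_right⟩
  have hl0 : l ≠ 0 := hlk.1.ne_zero
  have hk0 : k ≠ 0 := hlk.2.ne_zero
  have hcop : Nat.Coprime l k := Nat.coprime_of_squarefree_mul hm
  have key : (l * k).divisors.filter (l ∣ ·) = k.divisors.image (l * ·) := by
    ext d
    simp only [mem_filter, Nat.mem_divisors, mem_image]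
    constructor
    · rintro ⟨⟨hd, -⟩, e, rfl⟩
      exact ⟨e, ⟨Nat.dvd_of_mul_dvd_mul_left (Nat.pos_of_ne_zero hl0) hd, hk0⟩, rfl⟩
    · rintro ⟨e, ⟨he, -⟩, rfl⟩
      exact ⟨⟨Nat.mul_dvd_mul_left l he, hm.ne_zero⟩, dvd_mul_right _ _⟩
  rw [← sum_filter, key, sum_image fun x _ y _ h ↦ Nat.eq_of_mul_eq_mul_left
    (Nat.pos_of_ne_zero hl0) h]
  have h1 : ∀ e ∈ k.divisors, (μ (l * e) : ℝ) = μ l * μ e := by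
    intro e he
    rw [ArithmeticFunction.isMultiplicative_moebius.map_mul_of_coprime
      (hcop.coprime_dvd_right (Nat.dvd_of_mem_divisors he))]
    push_cast; rfl
  rw [sum_congr rfl h1, ← mul_sum]
  have h2 : (∑ e ∈ k.divisors, (μ e : ℝ)) = if k = 1 then 1 else 0 := by
    have := congrArg (fun f : ArithmeticFunction ℤ ↦ f k)
      ArithmeticFunction.moebius_mul_coe_zeta
    simp only [ArithmeticFunction.coe_mul_zeta_apply, ArithmeticFunction.one_apply] at this
    exact_mod_cast this
  rw [h2]
  have h3 : (l * k = l) ↔ k = 1 := by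
    constructor
    · intro h; exact Nat.eq_of_mul_eq_mul_left (Nat.pos_of_ne_zero hl0) (by simpa using h)
    · rintro rfl; simp
  simp [h3]

/-- The truncated sum of `selbergTerms` that governs the main term of the Selberg sieve. -/
noncomputable def selbergSum (s : BoundingSieve) (z : ℕ) : ℝ :=
  ∑ l ∈ s.prodPrimes.divisors with l ≤ z, s.selbergTerms l

theorem selbergSum_pos {z : ℕ} (hz : 1 ≤ z) : 0 < s.selbergSum z := by
  refine sum_pos (fun l hl ↦ selbergTerms_pos ?_) ⟨1, ?_⟩
  · exact Nat.dvd_of_mem_divisors (mem_filter.mp hl).1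
  · simp [hz, prodPrimes_ne_zero]

/-- The optimal weights of the Selberg sieve truncated at `z`. -/
noncomputable def selbergWeights (s : BoundingSieve) (z d : ℕ) : ℝ :=
  (s.nu d)⁻¹ * μ d * (∑ m ∈ s.prodPrimes.divisors with m ≤ z,
    if d ∣ m then s.selbergTerms m else 0) / s.selbergSum z

theorem selbergWeights_one {z : ℕ} (hz : 1 ≤ z) : s.selbergWeights z 1 = 1 := by
  have := (selbergSum_pos (s := s) hz).ne'
  have h : (∑ m ∈ s.prodPrimes.divisors with m ≤ z,
    if 1 ∣ m then s.selbergTerms m else 0) = s.selbergSum z := by simp [selbergSum]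
  rw [selbergWeights, h, s.nu_mult.map_one]
  simp [this]

theorem selbergWeights_eq_zero {z d : ℕ} (hd : z < d) : s.selbergWeights z d = 0 := by
  have h : (∑ m ∈ s.prodPrimes.divisors with m ≤ z,
      if d ∣ m then s.selbergTerms m else 0) = 0 := by
    refine sum_eq_zero fun m hm ↦ if_neg fun hdm ↦ ?_
    simp only [mem_filter, Nat.mem_divisors] at hm
    have := Nat.le_of_dvd (Nat.pos_of_dvd_of_pos hm.1.1
      (Nat.pos_of_ne_zero hm.1.2)) hdm
    omega
  simp [selbergWeights, h]

theorem abs_selbergWeights_le {z d : ℕ} (hz : 1 ≤ z) (hd : d ∣ s.prodPrimes) :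
    |s.selbergWeights z d| ≤ (s.nu d)⁻¹ := by
  have hS := selbergSum_pos (s := s) hz
  have hnu := nu_pos_of_dvd_prodPrimes hd
  have hpos : ∀ m ∈ s.prodPrimes.divisors.filter (· ≤ z), 0 < s.selbergTerms m :=
    fun m hm ↦ selbergTerms_pos (Nat.dvd_of_mem_divisors (mem_filter.mp hm).1)
  set T := ∑ m ∈ s.prodPrimes.divisors with m ≤ z,
    if d ∣ m then s.selbergTerms m else 0 with hT
  have hT0 : 0 ≤ T := sum_nonneg fun m hm ↦ by split_ifs <;> [exact (hpos m hm).le; rfl]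
  have hTS : T ≤ s.selbergSum z := sum_le_sum fun m hm ↦ by
    split_ifs <;> [rfl; exact (hpos m hm).le]
  have hmu : |(μ d : ℝ)| ≤ 1 := by exact_mod_cast ArithmeticFunction.abs_moebius_le_one
  rw [selbergWeights, ← hT, abs_div, abs_mul, abs_mul, abs_of_pos hS, abs_of_nonneg hT0,
    abs_of_pos (inv_pos.mpr hnu), div_le_iff₀ hS]
  have := inv_pos.mpr hnu
  calc _ ≤ (s.nu d)⁻¹ * 1 * s.selbergSum z := by gcongr
    _ = _ := by ring

theorem sum_nu_mul_selbergWeights {z l : ℕ} (hl : l ∣ s.prodPrimes) :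
    ∑ d ∈ s.prodPrimes.divisors, (if l ∣ d then s.nu d * s.selbergWeights z d else 0) =
      if l ≤ z then μ l * s.selbergTerms l / s.selbergSum z else 0 := by
  have h1 : ∀ d ∈ s.prodPrimes.divisors,
      (if l ∣ d then s.nu d * s.selbergWeights z d else 0) =
      ∑ m ∈ s.prodPrimes.divisors with m ≤ z, s.selbergTerms m / s.selbergSum z *
        (if d ∣ m then (if l ∣ d then (μ d : ℝ) else 0) else 0) := by
    intro d hd
    have hnu := nu_ne_zero (Nat.dvd_of_mem_divisors hd)
    split_ifs
    · rw [selbergWeights, mul_div_assoc, mul_assoc, mul_inv_cancel_left₀ hnu, sum_div, mul_sum]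
      refine sum_congr rfl fun m _ ↦ ?_
      split_ifs <;> ring
    · simp
  rw [sum_congr rfl h1, sum_comm]
  have h2 : ∀ m ∈ s.prodPrimes.divisors.filter (· ≤ z),
      (∑ d ∈ s.prodPrimes.divisors, s.selbergTerms m / s.selbergSum z *
        (if d ∣ m then (if l ∣ d then (μ d : ℝ) else 0) else 0)) =
      if m = l then μ l * s.selbergTerms l / s.selbergSum z else 0 := by
    intro m hm
    have hmP := Nat.dvd_of_mem_divisors (mem_filter.mp hm).1
    rw [← mul_sum, ← sum_filter, Nat.divisors_filter_dvd_of_dvd prodPrimes_ne_zero hmP]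
    by_cases hlm : l ∣ m
    · rw [sum_moebius_of_dvd_of_dvd (squarefree_of_dvd_prodPrimes hmP) hlm]
      split_ifs with h
      · subst h; ring
      · simp
    · rw [sum_eq_zero, if_neg (by rintro rfl; exact hlm dvd_rfl), mul_zero]
      intro d hd
      exact if_neg fun h ↦ hlm (h.trans (Nat.dvd_of_mem_divisors hd))
  rw [sum_congr rfl h2, sum_ite_eq']
  simp [hl, prodPrimes_ne_zero]

theorem mainSum_selbergWeights {z : ℕ} (hz : 1 ≤ z) :
    s.mainSum (lambdaSquared (s.selbergWeights z)) = (s.selbergSum z)⁻¹ := by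
  have hS := (selbergSum_pos (s := s) hz).ne'
  rw [mainSum_lambdaSquared_eq_sum_mul_sum_sq]
  have h1 : ∀ l ∈ s.prodPrimes.divisors, (s.selbergTerms l)⁻¹ *
      (∑ d ∈ s.prodPrimes.divisors, if l ∣ d then s.nu d * s.selbergWeights z d else 0) ^ 2 =
      if l ≤ z then s.selbergTerms l / s.selbergSum z ^ 2 else 0 := by
    intro l hl
    have hlP := Nat.dvd_of_mem_divisors hl
    have hg := (selbergTerms_pos hlP).ne'
    rw [sum_nu_mul_selbergWeights hlP]
    split_ifs
    · have hmu : (μ l : ℝ) ^ 2 = 1 := by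
        exact_mod_cast ArithmeticFunction.moebius_sq_eq_one_of_squarefree
          (squarefree_of_dvd_prodPrimes hlP)
      rw [div_pow, mul_pow, hmu]
      field_simp
    · simp
  rw [sum_congr rfl h1, ← sum_filter, ← sum_div, ← selbergSum]
  field_simp

theorem errSum_lambdaSquared_le (w : ℕ → ℝ) :
    s.errSum (lambdaSquared w) ≤ ∑ d₁ ∈ s.prodPrimes.divisors, ∑ d₂ ∈ s.prodPrimes.divisors,
      |w d₁| * |w d₂| * |s.rem (d₁.lcm d₂)| := by
  have h1 : ∀ d ∈ s.prodPrimes.divisors, |lambdaSquared w d| * |s.rem d| ≤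
      ∑ d₁ ∈ s.prodPrimes.divisors, ∑ d₂ ∈ s.prodPrimes.divisors,
        if d = d₁.lcm d₂ then |w d₁| * |w d₂| * |s.rem d| else 0 := by
    intro d hd
    have hsub := Nat.divisors_subset_of_dvd prodPrimes_ne_zero (Nat.dvd_of_mem_divisors hd)
    have hnn : ∀ d₁ d₂, 0 ≤ if d = Nat.lcm d₁ d₂ then |w d₁| * |w d₂| else 0 := by
      intro d₁ d₂; split_ifs <;> positivity
    calc |lambdaSquared w d| * |s.rem d|
        ≤ (∑ d₁ ∈ d.divisors, ∑ d₂ ∈ d.divisors,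
            if d = Nat.lcm d₁ d₂ then |w d₁| * |w d₂| else 0) * |s.rem d| := by
          gcongr
          refine (abs_sum_le_sum_abs _ _).trans (sum_le_sum fun d₁ _ ↦ ?_)
          refine (abs_sum_le_sum_abs _ _).trans (sum_le_sum fun d₂ _ ↦ ?_)
          split_ifs
          · rw [abs_mul]
          · simp
      _ ≤ (∑ d₁ ∈ s.prodPrimes.divisors, ∑ d₂ ∈ s.prodPrimes.divisors,
            if d = Nat.lcm d₁ d₂ then |w d₁| * |w d₂| else 0) * |s.rem d| := by
          gcongr
          refine (sum_le_sum_of_subset_of_nonneg hsub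
            fun d₁ _ _ ↦ sum_nonneg fun d₂ _ ↦ hnn d₁ d₂).trans (sum_le_sum fun d₁ _ ↦ ?_)
          exact sum_le_sum_of_subset_of_nonneg hsub fun d₂ _ _ ↦ hnn d₁ d₂
      _ = _ := by
          simp_rw [sum_mul, ite_mul, zero_mul]
  refine (sum_le_sum h1).trans_eq ?_
  rw [sum_comm]
  refine sum_congr rfl fun d₁ hd₁ ↦ ?_
  rw [sum_comm]
  refine sum_congr rfl fun d₂ hd₂ ↦ ?_
  rw [sum_ite_eq', if_pos]
  rw [Nat.mem_divisors]
  exact ⟨Nat.lcm_dvd (Nat.dvd_of_mem_divisors hd₁) (Nat.dvd_of_mem_divisors hd₂),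
    prodPrimes_ne_zero⟩

/-- A crude form of the Selberg sieve with level `z ^ 2`. -/
theorem siftedSum_le_div_selbergSum_add_pow {z : ℕ} (hz : 1 ≤ z)
    (hnu : ∀ d, d ∣ s.prodPrimes → (s.nu d)⁻¹ ≤ d) (hrem : ∀ d, d ∣ s.prodPrimes → |s.rem d| ≤ d) :
    s.siftedSum ≤ s.totalMass / s.selbergSum z + (z : ℝ) ^ 6 := by
  refine (siftedSum_le_mainSum_errSum_of_upperMoebius _
    (upperMoebius_lambdaSquared _ (selbergWeights_one (s := s) hz))).trans ?_
  rw [mainSum_selbergWeights hz, div_eq_mul_inv]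
  gcongr
  refine (errSum_lambdaSquared_le _).trans ?_
  have hw : ∀ d ∈ s.prodPrimes.divisors, |s.selbergWeights z d| ≤ if d ≤ z then (z : ℝ) else 0 := by
    intro d hd
    split_ifs with h
    · exact (abs_selbergWeights_le hz (Nat.dvd_of_mem_divisors hd)).trans
        ((hnu d (Nat.dvd_of_mem_divisors hd)).trans (by exact_mod_cast h))
    · rw [selbergWeights_eq_zero (not_le.mp h), abs_zero]
  have hterm : ∀ d₁ ∈ s.prodPrimes.divisors, ∀ d₂ ∈ s.prodPrimes.divisors,
      |s.selbergWeights z d₁| * |s.selbergWeights z d₂| * |s.rem (d₁.lcm d₂)| ≤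
      (if d₁ ≤ z then (z : ℝ) ^ 2 else 0) * (if d₂ ≤ z then (z : ℝ) ^ 2 else 0) := by
    intro d₁ hd₁ d₂ hd₂
    have h1 := hw d₁ hd₁
    have h2 := hw d₂ hd₂
    have hr : |s.rem (d₁.lcm d₂)| ≤ d₁ * d₂ := by
      refine (hrem _ (Nat.lcm_dvd (Nat.dvd_of_mem_divisors hd₁)
        (Nat.dvd_of_mem_divisors hd₂))).trans ?_
      exact_mod_cast Nat.lcm_le_mul (Nat.pos_of_mem_divisors hd₁) (Nat.pos_of_mem_divisors hd₂)
    split_ifs at h1 h2 ⊢ with ha hb hb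
    · have ha' : (d₁ : ℝ) ≤ z := by exact_mod_cast ha
      have hb' : (d₂ : ℝ) ≤ z := by exact_mod_cast hb
      calc _ ≤ (z : ℝ) * z * (d₁ * d₂) := by gcongr
        _ ≤ (z : ℝ) * z * (z * z) := by gcongr
        _ = _ := by ring
    all_goals simp_all
  refine (sum_le_sum fun d₁ hd₁ ↦ sum_le_sum fun d₂ hd₂ ↦ hterm d₁ hd₁ d₂ hd₂).trans ?_
  rw [← sum_mul_sum]
  have hcount : ∑ d ∈ s.prodPrimes.divisors, (if d ≤ z then (z : ℝ) ^ 2 else 0) ≤ z ^ 3 := by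
    rw [← sum_filter, sum_const, nsmul_eq_mul]
    have : #(s.prodPrimes.divisors.filter (· ≤ z)) ≤ z := by
      refine (card_le_card (t := Icc 1 z) fun d hd ↦ ?_).trans (by simp)
      simp only [mem_filter] at hd
      exact mem_Icc.mpr ⟨Nat.pos_of_mem_divisors hd.1, hd.2⟩
    calc _ ≤ (z : ℝ) * z ^ 2 := by gcongr
      _ = _ := by ring
  have h0 : 0 ≤ ∑ d ∈ s.prodPrimes.divisors, (if d ≤ z then (z : ℝ) ^ 2 else 0) :=
    sum_nonneg fun d _ ↦ by split_ifs <;> positivity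
  calc _ ≤ (z : ℝ) ^ 3 * z ^ 3 := by gcongr
    _ = _ := by ring

end BoundingSieve

namespace TauChi

open Finset

/-- The arithmetic function `n ↦ 1 / n`. -/
noncomputable def recip : ArithmeticFunction ℝ := ⟨fun n ↦ (n : ℝ)⁻¹, by simp⟩

/-- The arithmetic function `n ↦ χ₄(n) / n`. -/
noncomputable def chiRecip : ArithmeticFunction ℝ :=
  ⟨fun n ↦ ((ZMod.χ₄ n : ℤ) : ℝ) * (n : ℝ)⁻¹, by simp⟩

/-- The arithmetic function `n ↦ (1 * 1 * χ₄)(n) / n`, where `*` is Dirichlet convolution. -/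
noncomputable def tauChi : ArithmeticFunction ℝ := recip * recip * chiRecip

theorem recip_apply (n : ℕ) : recip n = (n : ℝ)⁻¹ := rfl

theorem chiRecip_apply (n : ℕ) : chiRecip n = ((ZMod.χ₄ n : ℤ) : ℝ) * (n : ℝ)⁻¹ := rfl

theorem recip_isMultiplicative : recip.IsMultiplicative := by
  refine ⟨by simp [recip_apply], fun {m n} _ ↦ ?_⟩
  simp [recip_apply, mul_comm]

theorem chiRecip_isMultiplicative : chiRecip.IsMultiplicative := by
  refine ⟨by simp [chiRecip_apply], fun {m n} _ ↦ ?_⟩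
  simp only [chiRecip_apply, Nat.cast_mul, map_mul, mul_inv, Int.cast_mul]
  ring

theorem tauChi_isMultiplicative : tauChi.IsMultiplicative :=
  (recip_isMultiplicative.mul recip_isMultiplicative).mul chiRecip_isMultiplicative

theorem mul_apply_prime_pow (f g : ArithmeticFunction ℝ) {p : ℕ} (hp : p.Prime) (k : ℕ) :
    (f * g) (p ^ k) = ∑ i ∈ range (k + 1), f (p ^ i) * g (p ^ (k - i)) := by
  rw [ArithmeticFunction.mul_apply, Nat.sum_divisorsAntidiagonal (fun a b ↦ f a * g b),
    Nat.divisors_prime_pow hp, sum_map]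
  refine sum_congr rfl fun i hi ↦ ?_
  simp only [Function.Embedding.coeFn_mk]
  rw [Nat.pow_div (by simpa [Nat.lt_succ_iff] using hi) hp.pos]

/-- The coefficients of `(1 - X)⁻² (1 - e X)⁻¹`. -/
def coeff (e : ℝ) (k : ℕ) : ℝ := ∑ i ∈ range (k + 1), ((i : ℝ) + 1) * e ^ (k - i)

theorem coeff_zero (e : ℝ) : coeff e 0 = 1 := by simp [coeff]

theorem coeff_succ (e : ℝ) (k : ℕ) : coeff e (k + 1) = e * coeff e k + (k + 2) := by
  rw [coeff, sum_range_succ, coeff, mul_sum]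
  congr 1
  · refine sum_congr rfl fun i hi ↦ ?_
    have : k + 1 - i = (k - i) + 1 := by have := mem_range.mp hi; omega
    rw [this, pow_succ]; ring
  · push_cast; simp; ring

theorem tauChi_prime_pow {p : ℕ} (hp : p.Prime) (k : ℕ) :
    tauChi (p ^ k) = coeff (ZMod.χ₄ p : ℤ) k / (p : ℝ) ^ k := by
  have hp0 : (p : ℝ) ≠ 0 := by exact_mod_cast hp.ne_zero
  have h2 : ∀ i : ℕ, (recip * recip) (p ^ i) = ((i : ℝ) + 1) / (p : ℝ) ^ i := by
    intro i
    rw [mul_apply_prime_pow _ _ hp]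
    have : ∀ j ∈ range (i + 1), recip (p ^ j) * recip (p ^ (i - j)) = ((p : ℝ) ^ i)⁻¹ := by
      intro j hj
      have hji : j ≤ i := by have := mem_range.mp hj; omega
      rw [recip_apply, recip_apply, ← mul_inv]
      norm_cast
      rw [← pow_add, Nat.add_sub_cancel' hji]
    rw [sum_congr rfl this]
    simp [div_eq_mul_inv]
  rw [tauChi, mul_apply_prime_pow _ _ hp, coeff, sum_div]
  refine sum_congr rfl fun i hi ↦ ?_
  have hik : i ≤ k := by have := mem_range.mp hi; omega
  rw [h2, chiRecip_apply]
  push_cast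
  rw [map_pow]
  push_cast
  rw [← Nat.add_sub_cancel' hik]
  simp only [Nat.add_sub_cancel_left, pow_add]
  field_simp

theorem abs_coeff_le {e : ℝ} (he : |e| ≤ 1) (k : ℕ) :
    |coeff e k| ≤ ((k : ℝ) + 1) * (k + 2) / 2 := by
  induction k with
  | zero => simp [coeff_zero]
  | succ k ih =>
    rw [coeff_succ]
    calc |e * coeff e k + (k + 2)| ≤ |e * coeff e k| + |(k : ℝ) + 2| := abs_add_le _ _
      _ ≤ 1 * (((k : ℝ) + 1) * (k + 2) / 2) + (k + 2) := by
          rw [abs_mul, abs_of_nonneg (by positivity : (0 : ℝ) ≤ k + 2)]; gcongr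
      _ = _ := by push_cast; ring

theorem coeff_neg_one (k : ℕ) :
    1 ≤ coeff (-1) k ∧ coeff (-1) (k + 1) ≤ 2 ^ k ∧ coeff (-1) k ≤ k + 1 := by
  induction k using Nat.twoStepInduction with
  | zero => simp [coeff_succ, coeff_zero]; norm_num
  | one => simp [coeff_succ, coeff_zero]; norm_num
  | more k ih1 ih2 =>
    have h2 := coeff_succ (-1) k
    have h3 := coeff_succ (-1) (k + 1)
    have h4 := coeff_succ (-1) (k + 2)
    push_cast at h3 h4 ih2 ⊢
    have hpow : (1 : ℝ) ≤ 2 ^ k := one_le_pow₀ (by norm_num)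
    have e1 : (2 : ℝ) ^ (k + 2) = 4 * 2 ^ k := by ring
    have e2 : (2 : ℝ) ^ (k + 1) = 2 * 2 ^ k := by ring
    rw [e1]
    rw [e2] at ih2
    refine ⟨by linarith, by linarith, by linarith⟩

theorem coeff_nonneg {e : ℝ} (he : e = 0 ∨ e = 1 ∨ e = -1) (k : ℕ) : 0 ≤ coeff e k := by
  rcases he with rfl | rfl | rfl
  · exact sum_nonneg fun i _ ↦ by positivity
  · exact sum_nonneg fun i _ ↦ by positivity
  · linarith [(coeff_neg_one k).1]

theorem chi_cases (n : ℕ) :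
    ((ZMod.χ₄ n : ℤ) : ℝ) = 0 ∨ ((ZMod.χ₄ n : ℤ) : ℝ) = 1 ∨ ((ZMod.χ₄ n : ℤ) : ℝ) = -1 := by
  rcases ZMod.isQuadratic_χ₄ n with h | h | h <;> simp [h]

theorem tauChi_nonneg (n : ℕ) : 0 ≤ tauChi n := by
  rcases eq_or_ne n 0 with rfl | hn
  · simp
  · rw [tauChi_isMultiplicative.multiplicative_factorization tauChi hn]
    refine prod_nonneg fun p hp ↦ ?_
    have hp' : p.Prime := Nat.prime_of_mem_primeFactors (by simpa using hp)
    simp only [tauChi_prime_pow hp']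
    exact div_nonneg (coeff_nonneg (chi_cases p) _) (by positivity)

theorem geom_sum_le {r : ℝ} (h0 : 0 ≤ r) (h1 : r < 1) (K : ℕ) :
    ∑ k ∈ range K, r ^ k ≤ (1 - r)⁻¹ := by
  rw [← tsum_geometric_of_lt_one h0 h1]
  exact (summable_geometric_of_lt_one h0 h1).sum_le_tsum _ fun _ _ ↦ by positivity

theorem sum_tauChi_prime_pow_le {p : ℕ} (hp : p.Prime) {A r : ℝ} (hr0 : 0 ≤ r) (hA : 0 ≤ A)
    (hr : r < p) (h : ∀ k, coeff (ZMod.χ₄ p : ℤ) (k + 1) ≤ A * r ^ k) (K : ℕ) :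
    ∑ k ∈ range K, tauChi (p ^ (k + 1)) ≤ A / (p - r) := by
  have hp0 : (0 : ℝ) < p := by exact_mod_cast hp.pos
  calc ∑ k ∈ range K, tauChi (p ^ (k + 1)) ≤ ∑ k ∈ range K, A / p * (r / p) ^ k := by
        refine sum_le_sum fun k _ ↦ ?_
        rw [tauChi_prime_pow hp]
        calc _ ≤ A * r ^ k / (p : ℝ) ^ (k + 1) := by gcongr; exact h k
          _ = _ := by rw [div_pow, pow_succ]; field_simp
    _ = A / p * ∑ k ∈ range K, (r / p) ^ k := by rw [mul_sum]
    _ ≤ A / p * (1 - r / p)⁻¹ := by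
        gcongr
        exact geom_sum_le (by positivity) (by rwa [div_lt_one hp0]) K
    _ = _ := by
        have : (p : ℝ) - r ≠ 0 := by linarith
        have h' : 1 - r / p ≠ 0 := by
          rw [sub_ne_zero]; intro h; field_simp at h; linarith
        field_simp

theorem sum_tauChi_prime_pow_le_of_prime {p : ℕ} (hp : p.Prime) (K : ℕ) :
    ∑ k ∈ range K, tauChi (p ^ (k + 1)) ≤ 18 / p := by
  have hp2 : (2 : ℝ) ≤ p := by exact_mod_cast hp.two_le
  have he : |((ZMod.χ₄ p : ℤ) : ℝ)| ≤ 1 := by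
    rcases chi_cases p with h | h | h <;> rw [h] <;> norm_num
  have hquad : ∀ k : ℕ, ((k : ℝ) + 2) * (k + 3) / 2 ≤ 9 / 2 * (3 / 2) ^ k := by
    intro k
    induction k with
    | zero => norm_num
    | succ k ih =>
      rcases k with _ | _ | k
      · norm_num
      · norm_num
      · rw [pow_succ]
        push_cast at ih ⊢
        nlinarith [mul_nonneg (Nat.cast_nonneg (α := ℝ) k) (Nat.cast_nonneg (α := ℝ) k),
          Nat.cast_nonneg (α := ℝ) k]
  refine (sum_tauChi_prime_pow_le hp (A := 9 / 2) (r := 3 / 2) (by norm_num) (by norm_num)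
    (by linarith) (fun k ↦ ?_) K).trans ?_
  · refine (le_abs_self _).trans ((abs_coeff_le he (k + 1)).trans ?_)
    refine le_trans (le_of_eq ?_) (hquad k)
    push_cast; ring
  · rw [div_le_div_iff₀ (by linarith) (by linarith)]
    linarith

theorem sum_tauChi_prime_pow_le_of_one_mod_four {p : ℕ} (hp : p.Prime) (h4 : p % 4 = 1) (K : ℕ) :
    ∑ k ∈ range K, tauChi (p ^ (k + 1)) ≤ 3 / (p - 3) := by
  have hp3 : 3 < p := by
    have := hp.two_le
    omega
  refine sum_tauChi_prime_pow_le hp (by norm_num) (by norm_num) (by exact_mod_cast hp3)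
    (fun k ↦ ?_) K
  rw [ZMod.χ₄_nat_one_mod_four h4]
  refine (le_abs_self _).trans ((abs_coeff_le (by simp) (k + 1)).trans ?_)
  induction k with
  | zero => norm_num
  | succ k ih =>
    rw [pow_succ]
    push_cast at ih ⊢
    nlinarith [mul_nonneg (Nat.cast_nonneg (α := ℝ) k) (Nat.cast_nonneg (α := ℝ) k),
      Nat.cast_nonneg (α := ℝ) k]

theorem sum_tauChi_prime_pow_le_of_three_mod_four {p : ℕ} (hp : p.Prime) (h5 : 5 ≤ p)
    (h4 : p % 4 = 3) (K : ℕ) :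
    ∑ k ∈ range K, tauChi (p ^ (k + 1)) ≤ 1 / (p - 1) + 3 / (p : ℝ) ^ 2 := by
  have hp5 : (5 : ℝ) ≤ p := by exact_mod_cast h5
  refine (sum_tauChi_prime_pow_le hp (A := 1) (r := 2) (by norm_num) (by norm_num)
    (by linarith) (fun k ↦ ?_) K).trans ?_
  · rw [ZMod.χ₄_nat_three_mod_four h4]
    simpa using (coeff_neg_one k).2.1
  · rw [div_add_div _ _ (by linarith) (by positivity),
      div_le_div_iff₀ (by linarith) (by have : (0 : ℝ) < p - 1 := by linarith
                                        positivity)]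
    nlinarith [sq_nonneg ((p : ℝ) - 5)]

theorem log_add_one_le_sum_recip (n : ℕ) : log (n + 1) ≤ ∑ k ∈ Ioc 0 n, recip k := by
  have h := log_add_one_le_harmonic n
  rw [harmonic_eq_sum_Icc] at h
  push_cast at h
  exact h

theorem sq_log_le_sum_recip_mul_recip (z : ℕ) :
    (log (z + 1) / 2) ^ 2 ≤ ∑ n ∈ Ioc 0 z, (recip * recip) n := by
  have hlog : log (z + 1) / 2 ≤ log ((Nat.sqrt z : ℝ) + 1) := by
    have h : (z : ℝ) + 1 ≤ ((Nat.sqrt z : ℝ) + 1) ^ 2 := by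
      have := Nat.succ_le_succ_sqrt' z
      exact_mod_cast this
    have := log_le_log (by positivity) h
    rw [log_pow] at this
    push_cast at this
    linarith
  have h0 : 0 ≤ log ((z : ℝ) + 1) / 2 := by
    have := log_nonneg (show (1 : ℝ) ≤ z + 1 by linarith [Nat.cast_nonneg (α := ℝ) z])
    linarith
  have hrec : ∀ n, 0 ≤ recip n := fun n ↦ by rw [recip_apply]; positivity
  have hmain := hlog.trans (log_add_one_le_sum_recip (Nat.sqrt z))
  have hsq : Nat.sqrt z ≤ z := Nat.sqrt_le_self z
  rw [ArithmeticFunction.sum_Ioc_mul_eq_sum_sum]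
  calc (log (z + 1) / 2) ^ 2 ≤ (∑ k ∈ Ioc 0 (Nat.sqrt z), recip k) ^ 2 := by gcongr
    _ = ∑ n ∈ Ioc 0 (Nat.sqrt z), recip n * ∑ m ∈ Ioc 0 (Nat.sqrt z), recip m := by
        rw [sq, sum_mul]
    _ ≤ ∑ n ∈ Ioc 0 (Nat.sqrt z), recip n * ∑ m ∈ Ioc 0 (z / n), recip m := by
        refine sum_le_sum fun n hn ↦ mul_le_mul_of_nonneg_left ?_ (hrec n)
        refine sum_le_sum_of_subset_of_nonneg (Ioc_subset_Ioc_right ?_) fun _ _ _ ↦ hrec _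
        rw [mem_Ioc] at hn
        rw [Nat.le_div_iff_mul_le hn.1]
        calc _ ≤ Nat.sqrt z * Nat.sqrt z := by gcongr; exact hn.2
          _ ≤ z := Nat.sqrt_le z
    _ ≤ _ := by
        refine sum_le_sum_of_subset_of_nonneg (Ioc_subset_Ioc_right hsq) fun n _ _ ↦ ?_
        exact mul_nonneg (hrec n) (sum_nonneg fun m _ ↦ hrec m)

theorem sub_le_sum_chi_mul {u : ℕ → ℝ} (hu : ∀ m n, 1 ≤ m → m ≤ n → u n ≤ u m) (K : ℕ) :
    u 1 - u 3 ≤ ∑ d ∈ range (4 * (K + 1)), ((ZMod.χ₄ d : ℤ) : ℝ) * u d := by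
  induction K with
  | zero =>
    simp [sum_range_succ, sub_eq_add_neg]
  | succ K ih =>
    rw [show 4 * (K + 1 + 1) = 4 * (K + 1) + 1 + 1 + 1 + 1 by ring]
    simp only [sum_range_succ]
    have h0 : (ZMod.χ₄ ((4 * (K + 1) : ℕ)) : ℤ) = 0 := by
      rw [ZMod.χ₄_nat_eq_if_mod_four, if_pos (by omega)]
    have h1 : (ZMod.χ₄ ((4 * (K + 1) + 1 : ℕ)) : ℤ) = 1 :=
      ZMod.χ₄_nat_one_mod_four (by omega)
    have h2 : (ZMod.χ₄ ((4 * (K + 1) + 1 + 1 : ℕ)) : ℤ) = 0 := by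
      rw [ZMod.χ₄_nat_eq_if_mod_four, if_pos (by omega)]
    have h3 : (ZMod.χ₄ ((4 * (K + 1) + 1 + 1 + 1 : ℕ)) : ℤ) = -1 :=
      ZMod.χ₄_nat_three_mod_four (by omega)
    rw [h0, h1, h2, h3]
    have := hu (4 * (K + 1) + 1) (4 * (K + 1) + 1 + 1 + 1) (by omega) (by omega)
    push_cast
    linarith

theorem sq_log_le_sum_tauChi (z : ℕ) :
    (log (z + 1)) ^ 2 / 6 ≤ ∑ n ∈ Ioc 0 z, tauChi n := by
  set T : ℕ → ℝ := fun t ↦ ∑ n ∈ Ioc 0 t, (recip * recip) n with hT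
  have hrr : ∀ n, 0 ≤ (recip * recip) n := fun n ↦ by
    rw [ArithmeticFunction.mul_apply]
    exact sum_nonneg fun x _ ↦ by rw [recip_apply, recip_apply]; positivity
  have hT0 : ∀ t, 0 ≤ T t := fun t ↦ sum_nonneg fun n _ ↦ hrr n
  have hTm : Monotone T := fun s t hst ↦
    sum_le_sum_of_subset_of_nonneg (Ioc_subset_Ioc_right hst) fun n _ _ ↦ hrr n
  set u : ℕ → ℝ := fun d ↦ (d : ℝ)⁻¹ * T (z / d) with hu
  have hum : ∀ m n, 1 ≤ m → m ≤ n → u n ≤ u m := by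
    intro m n hm hmn
    have hm' : (0 : ℝ) < m := by exact_mod_cast hm
    refine mul_le_mul (by gcongr) (hTm (Nat.div_le_div_left hmn hm)) (hT0 _) (by positivity)
  have hsum : ∑ n ∈ Ioc 0 z, tauChi n =
      ∑ d ∈ range (4 * (z + 1)), ((ZMod.χ₄ d : ℤ) : ℝ) * u d := by
    rw [tauChi, mul_comm, ArithmeticFunction.sum_Ioc_mul_eq_sum_sum]
    have hsub : Ioc 0 z ⊆ range (4 * (z + 1)) := fun d hd ↦ by
      simp only [mem_Ioc, mem_range] at hd ⊢; omega
    rw [← sum_subset hsub]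
    · refine sum_congr rfl fun d _ ↦ ?_
      rw [chiRecip_apply, hu, hT]; ring
    · intro d _ hd
      simp only [mem_Ioc, not_and, not_le] at hd
      rcases Nat.eq_zero_or_pos d with rfl | hd0
      · simp
      · simp [hu, hT, Nat.div_eq_of_lt (hd hd0)]
  rw [hsum]
  refine le_trans ?_ (sub_le_sum_chi_mul hum z)
  have h3 : u 3 ≤ u 1 / 3 := by
    have := hTm (Nat.div_le_self z 3)
    simp only [hu, Nat.div_one, Nat.cast_one, inv_one, one_mul, Nat.cast_ofNat]
    linarith
  have h1 : u 1 = T z := by simp [hu]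
  have := sq_log_le_sum_recip_mul_recip z
  change _ ≤ T z at this
  linarith [this]

end TauChi

section TruncatedSums

open Finset

/-- The sum of `h` over the positive integers up to `z` all of whose prime factors lie in `s`. -/
noncomputable def factoredSum (h : ArithmeticFunction ℝ) (s : Finset ℕ) (z : ℕ) : ℝ :=
  ∑ n ∈ Ioc 0 z with n.primeFactors ⊆ s, h n

theorem factoredSum_nonneg {h : ArithmeticFunction ℝ} (hh : ∀ n, 0 ≤ h n) (s : Finset ℕ) (z : ℕ) :
    0 ≤ factoredSum h s z := sum_nonneg fun n _ ↦ hh n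

theorem factoredSum_insert_le {h : ArithmeticFunction ℝ} (hh : ∀ n, 0 ≤ h n)
    (hmul : h.IsMultiplicative) {s : Finset ℕ} {p : ℕ} (hp : p.Prime) (hps : p ∉ s) (z : ℕ) :
    factoredSum h (insert p s) z ≤
      factoredSum h s z + (∑ k ∈ range z, h (p ^ (k + 1))) * factoredSum h s (z / p) := by
  set A : ℕ → Finset ℕ := fun t ↦ (Ioc 0 t).filter (fun n ↦ n.primeFactors ⊆ s) with hA
  have hsub : (Ioc 0 z).filter (fun n ↦ n.primeFactors ⊆ insert p s) ⊆
      A z ∪ (range z ×ˢ A (z / p)).image (fun x ↦ p ^ (x.1 + 1) * x.2) := by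
    intro n hn
    simp only [mem_filter, mem_Ioc] at hn
    obtain ⟨⟨hn0, hnz⟩, hns⟩ := hn
    by_cases hpn : p ∣ n
    · obtain ⟨k, m, hpm, rfl⟩ := Nat.exists_eq_pow_mul_and_not_dvd hn0.ne' p hp.ne_one
      have hm0 : 0 < m := Nat.pos_of_mul_pos_left hn0
      have hk : k ≠ 0 := by rintro rfl; simp at hpn; exact hpm hpn
      obtain ⟨k, rfl⟩ := Nat.exists_eq_succ_of_ne_zero hk
      refine mem_union_right _ (mem_image.mpr ⟨(k, m), ?_, rfl⟩)
      have hkz : k < z := by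
        calc k < k + 1 := Nat.lt_succ_self k
          _ ≤ p ^ (k + 1) := (Nat.lt_pow_self hp.one_lt).le
          _ ≤ p ^ (k + 1) * m := Nat.le_mul_of_pos_right _ hm0
          _ ≤ z := hnz
      simp only [hA, mem_product, mem_range, mem_filter, mem_Ioc]
      refine ⟨hkz, ⟨hm0, ?_⟩, fun q hq ↦ ?_⟩
      · rw [Nat.le_div_iff_mul_le hp.pos, mul_comm]
        refine le_trans ?_ hnz
        gcongr
        exact Nat.le_self_pow (by omega) p
      · have hq' := hns (Nat.primeFactors_mono (dvd_mul_left m _) hn0.ne' hq)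
        rcases mem_insert.mp hq' with rfl | h
        · exact absurd (Nat.dvd_of_mem_primeFactors hq) hpm
        · exact h
    · refine mem_union_left _ ?_
      simp only [hA, mem_filter, mem_Ioc]
      refine ⟨⟨hn0, hnz⟩, fun q hq ↦ ?_⟩
      rcases mem_insert.mp (hns hq) with rfl | h
      · exact absurd (Nat.dvd_of_mem_primeFactors hq) hpn
      · exact h
  have hcop : ∀ k, ∀ m ∈ A (z / p), h (p ^ (k + 1) * m) = h (p ^ (k + 1)) * h m := by
    intro k m hm
    simp only [hA, mem_filter, mem_Ioc] at hm
    refine hmul.map_mul_of_coprime (Nat.Coprime.pow_left _ ((Nat.Prime.coprime_iff_not_dvd hp).mpr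
      fun hpm ↦ hps (hm.2 ?_)))
    exact Nat.mem_primeFactors.mpr ⟨hp, hpm, hm.1.1.ne'⟩
  have hinj : Set.InjOn (fun x : ℕ × ℕ ↦ p ^ (x.1 + 1) * x.2)
      (range z ×ˢ A (z / p) : Finset (ℕ × ℕ)) := by
    have hnd : ∀ m ∈ A (z / p), ¬ p ∣ m := by
      intro m hm hpm
      simp only [hA, mem_filter, mem_Ioc] at hm
      exact hps (hm.2 (Nat.mem_primeFactors.mpr ⟨hp, hpm, hm.1.1.ne'⟩))
    rintro ⟨k, m⟩ hkm ⟨k', m'⟩ hkm' heq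
    simp only [coe_product, Set.mem_prod, mem_coe] at hkm hkm' heq
    have h1 := hnd m hkm.2
    have h2 := hnd m' hkm'.2
    have hm0 : m ≠ 0 := by rintro rfl; simp at h1
    have hm0' : m' ≠ 0 := by rintro rfl; simp at h2
    have hf := congrArg (fun n ↦ n.factorization p) heq
    simp only [Nat.factorization_mul (pow_ne_zero _ hp.ne_zero) hm0,
      Nat.factorization_mul (pow_ne_zero _ hp.ne_zero) hm0', Finsupp.add_apply,
      hp.factorization_pow, Finsupp.single_eq_same, Nat.factorization_eq_zero_of_not_dvd h1,
      Nat.factorization_eq_zero_of_not_dvd h2] at hf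
    have hk : k = k' := by omega
    subst hk
    have := Nat.eq_of_mul_eq_mul_left (pow_pos hp.pos _) heq
    rw [this]
  calc factoredSum h (insert p s) z
      ≤ ∑ n ∈ A z ∪ (range z ×ˢ A (z / p)).image (fun x ↦ p ^ (x.1 + 1) * x.2), h n :=
        sum_le_sum_of_subset_of_nonneg hsub fun n _ _ ↦ hh n
    _ ≤ ∑ n ∈ A z, h n +
        ∑ n ∈ (range z ×ˢ A (z / p)).image (fun x ↦ p ^ (x.1 + 1) * x.2), h n := by
        rw [← sum_union_inter]
        exact le_add_of_nonneg_right (sum_nonneg fun n _ ↦ hh n)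
    _ = factoredSum h s z + ∑ x ∈ range z ×ˢ A (z / p), h (p ^ (x.1 + 1) * x.2) := by
        rw [sum_image hinj]; rfl
    _ = _ := by
        rw [sum_product, sum_mul]
        congr 1
        refine sum_congr rfl fun k _ ↦ ?_
        rw [factoredSum, mul_sum]
        exact sum_congr rfl fun m hm ↦ hcop k m hm

/-- The sum of `g` over the divisors of `P` up to `z`. -/
noncomputable def divisorSum (g : ArithmeticFunction ℝ) (P z : ℕ) : ℝ :=
  ∑ l ∈ P.divisors with l ≤ z, g l

theorem divisorSum_prime_mul_ge {g : ArithmeticFunction ℝ} (hmul : g.IsMultiplicative) {P p : ℕ}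
    (hP : P ≠ 0) (hg : ∀ l, l ∣ p * P → 0 ≤ g l) (hp : p.Prime) (hpP : ¬ p ∣ P) (z : ℕ) :
    divisorSum g P z + g p * divisorSum g P (z / p) ≤ divisorSum g (p * P) z := by
  have hinj : Function.Injective (fun l ↦ p * l) := fun x y h ↦
    Nat.eq_of_mul_eq_mul_left hp.pos h
  have hdisj : Disjoint (P.divisors.filter (· ≤ z))
      ((P.divisors.filter (· ≤ z / p)).image (fun l ↦ p * l)) := by
    rw [disjoint_left]
    rintro l hl hl'
    obtain ⟨m, -, rfl⟩ := mem_image.mp hl'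
    exact hpP ((dvd_mul_right p m).trans (Nat.dvd_of_mem_divisors (mem_filter.mp hl).1))
  have himg : g p * divisorSum g P (z / p) =
      ∑ l ∈ (P.divisors.filter (· ≤ z / p)).image (fun l ↦ p * l), g l := by
    rw [sum_image hinj.injOn, divisorSum, mul_sum]
    refine sum_congr rfl fun l hl ↦ (hmul.map_mul_of_coprime ?_).symm
    refine (Nat.Prime.coprime_iff_not_dvd hp).mpr fun h ↦ hpP (h.trans ?_)
    exact Nat.dvd_of_mem_divisors (mem_filter.mp hl).1
  rw [himg, divisorSum, ← sum_union hdisj]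
  refine sum_le_sum_of_subset_of_nonneg ?_ fun l hl _ ↦ hg l ?_
  · intro l hl
    rcases mem_union.mp hl with hl | hl
    · simp only [mem_filter, Nat.mem_divisors] at hl ⊢
      exact ⟨⟨hl.1.1.mul_left p, mul_ne_zero hp.ne_zero hP⟩, hl.2⟩
    · obtain ⟨m, hm, rfl⟩ := mem_image.mp hl
      simp only [mem_filter, Nat.mem_divisors] at hm ⊢
      refine ⟨⟨Nat.mul_dvd_mul_left p hm.1.1, mul_ne_zero hp.ne_zero hP⟩, ?_⟩
      rw [mul_comm]
      exact (Nat.le_div_iff_mul_le hp.pos).mp hm.2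
  · exact Nat.dvd_of_mem_divisors (mem_filter.mp hl).1

theorem divisorSum_mono {g : ArithmeticFunction ℝ} {P : ℕ} (hg : ∀ l, l ∣ P → 0 ≤ g l) :
    Monotone (divisorSum g P) := fun y z hyz ↦ by
  refine sum_le_sum_of_subset_of_nonneg (fun l hl ↦ ?_) fun l hl _ ↦
    hg l (Nat.dvd_of_mem_divisors (mem_filter.mp hl).1)
  rw [mem_filter] at hl ⊢
  exact ⟨hl.1, hl.2.trans hyz⟩

theorem divisorSum_nonneg {g : ArithmeticFunction ℝ} {P : ℕ} (hg : ∀ l, l ∣ P → 0 ≤ g l) (z : ℕ) :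
    0 ≤ divisorSum g P z := sum_nonneg fun l hl ↦
  hg l (Nat.dvd_of_mem_divisors (mem_filter.mp hl).1)

/-- If the prime power sums of `h` exceed the values at primes of `g`, which is supported on the
primes satisfying `good`, by at most `c`, then the truncated sums of `h` exceed those of `g` by
at most the factor `∏ (1 + c p)`. -/
theorem factoredSum_le_prod_mul_divisorSum {h g : ArithmeticFunction ℝ} (hh : ∀ n, 0 ≤ h n)
    (hhmul : h.IsMultiplicative) (hgmul : g.IsMultiplicative) (good : ℕ → Prop)
    [DecidablePred good] (c : ℕ → ℝ) (hc : ∀ p, 0 ≤ c p) (s : Finset ℕ)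
    (hs : ∀ p ∈ s, p.Prime) (hg : ∀ l, l ∣ ∏ p ∈ s with good p, p → 0 ≤ g l)
    (hgood : ∀ p ∈ s, good p → ∀ K, ∑ k ∈ range K, h (p ^ (k + 1)) ≤ g p + c p)
    (hbad : ∀ p ∈ s, ¬ good p → ∀ K, ∑ k ∈ range K, h (p ^ (k + 1)) ≤ c p) (z : ℕ) :
    factoredSum h s z ≤ (∏ p ∈ s, (1 + c p)) * divisorSum g (∏ p ∈ s with good p, p) z := by
  induction s using Finset.induction_on generalizing z with
  | empty =>
    simp only [factoredSum, divisorSum, prod_empty, filter_empty, Nat.divisors_one, one_mul]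
    refine (sum_le_sum_of_subset_of_nonneg (t := ({1} : Finset ℕ).filter (· ≤ z)) ?_
      fun n _ _ ↦ hh n).trans_eq ?_
    · intro n hn
      simp only [mem_filter, mem_Ioc, subset_empty, Nat.primeFactors_eq_empty] at hn
      simp only [mem_filter, mem_singleton]
      omega
    · refine sum_congr rfl fun n hn ↦ ?_
      simp only [mem_filter, mem_singleton] at hn
      rw [hn.1, hhmul.map_one, hgmul.map_one]
  | insert p s hps ih =>
    have hp : p.Prime := hs p (mem_insert_self p s)
    have hprod0 : ∏ q ∈ s with good q, q ≠ 0 := prod_ne_zero_iff.mpr fun q hq ↦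
      (hs q (mem_insert_of_mem (mem_filter.mp hq).1)).ne_zero
    have hpn : ¬ p ∣ ∏ q ∈ s with good q, q := by
      rw [Prime.dvd_finsetProd_iff hp.prime]
      rintro ⟨q, hq, hpq⟩
      have hqs := (mem_filter.mp hq).1
      rw [(Nat.prime_dvd_prime_iff_eq hp (hs q (mem_insert_of_mem hqs))).mp hpq] at hps
      exact hps hqs
    have hdvd : ∏ q ∈ s with good q, q ∣ ∏ q ∈ insert p s with good q, q :=
      prod_dvd_prod_of_subset _ _ _ (filter_subset_filter _ (subset_insert p s))
    have hg' : ∀ l, l ∣ ∏ q ∈ s with good q, q → 0 ≤ g l := fun l hl ↦ hg l (hl.trans hdvd)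
    have ih' := ih (fun q hq ↦ hs q (mem_insert_of_mem hq)) hg'
      (fun q hq ↦ hgood q (mem_insert_of_mem hq)) (fun q hq ↦ hbad q (mem_insert_of_mem hq))
    have hstep := factoredSum_insert_le hh hhmul hp hps z
    have hB0 : 0 ≤ ∏ q ∈ s, (1 + c q) := prod_nonneg fun q _ ↦ by linarith [hc q]
    have hcp := hc p
    have hD0 := divisorSum_nonneg hg' z
    have hD0' := divisorSum_nonneg hg' (z / p)
    have hDm := divisorSum_mono hg' (Nat.div_le_self z p)
    have hF0 := factoredSum_nonneg hh s (z / p)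
    rw [prod_insert hps]
    by_cases hgp : good p
    · have hgp0 : 0 ≤ g p := hg p (dvd_prod_of_mem (fun q ↦ q) (by simp [hgp]))
      have hPeq : ∏ q ∈ insert p s with good q, q = p * ∏ q ∈ s with good q, q := by
        rw [filter_insert, if_pos hgp, prod_insert (by simp [hps])]
      rw [hPeq] at hg ⊢
      have hlow := divisorSum_prime_mul_ge hgmul hprod0 hg hp hpn z
      calc _ ≤ _ := hstep
        _ ≤ (∏ q ∈ s, (1 + c q)) * divisorSum g (∏ q ∈ s with good q, q) z + (g p + c p) *
            ((∏ q ∈ s, (1 + c q)) * divisorSum g (∏ q ∈ s with good q, q) (z / p)) := by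
            gcongr
            · exact ih' z
            · exact hgood p (mem_insert_self p s) hgp z
            · exact ih' (z / p)
        _ = (∏ q ∈ s, (1 + c q)) * ((divisorSum g (∏ q ∈ s with good q, q) z +
            g p * divisorSum g (∏ q ∈ s with good q, q) (z / p)) +
            c p * divisorSum g (∏ q ∈ s with good q, q) (z / p)) := by ring
        _ ≤ (∏ q ∈ s, (1 + c q)) * (divisorSum g (p * ∏ q ∈ s with good q, q) z +
            c p * divisorSum g (p * ∏ q ∈ s with good q, q) z) := by
            gcongr
            refine hDm.trans (le_trans ?_ hlow)
            exact le_add_of_nonneg_right (mul_nonneg hgp0 hD0')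
        _ = _ := by ring
    · have hPeq : ∏ q ∈ insert p s with good q, q = ∏ q ∈ s with good q, q := by
        rw [filter_insert, if_neg hgp]
      rw [hPeq]
      calc _ ≤ _ := hstep
        _ ≤ (∏ q ∈ s, (1 + c q)) * divisorSum g (∏ q ∈ s with good q, q) z + c p *
            ((∏ q ∈ s, (1 + c q)) * divisorSum g (∏ q ∈ s with good q, q) z) := by
            gcongr
            · exact ih' z
            · exact hbad p (mem_insert_self p s) hgp z
            · exact (ih' (z / p)).trans (by gcongr)
        _ = _ := by ring

end TruncatedSums

section PrimeReciprocals

open Finset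

theorem sum_inv_prime_le_two_pow (m : ℕ) :
    ∑ p ∈ Ioc 0 (2 ^ (m + 1) : ℕ) with p.Prime, (p : ℝ)⁻¹ ≤ 1 + 4 * (harmonic m : ℝ) := by
  induction m with
  | zero =>
    have : (Ioc 0 (2 ^ (0 + 1))).filter Nat.Prime = {2} := by decide
    rw [this]; norm_num
  | succ m ih =>
    rw [harmonic_succ]
    have hlog2 : 0 < log 2 := log_pos (by norm_num)
    have hm : (0 : ℝ) < (m : ℝ) + 1 := by positivity
    have hsplit : (Ioc 0 (2 ^ (m + 1 + 1))).filter Nat.Prime =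
        (Ioc 0 (2 ^ (m + 1))).filter Nat.Prime ∪
          (Ioc (2 ^ (m + 1)) (2 ^ (m + 1 + 1))).filter Nat.Prime := by
      rw [← filter_union, Ioc_union_Ioc_eq_Ioc (Nat.zero_le _)
        (Nat.pow_le_pow_right (by norm_num) (by omega))]
    have hblock : ∑ p ∈ Ioc (2 ^ (m + 1) : ℕ) (2 ^ (m + 1 + 1)) with p.Prime, (p : ℝ)⁻¹ ≤
        4 / ((m : ℝ) + 1) := by
      have hle : ∀ p ∈ (Ioc (2 ^ (m + 1)) (2 ^ (m + 1 + 1))).filter Nat.Prime, (p : ℝ)⁻¹ ≤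
          log p / (((m : ℝ) + 1) * log 2 * 2 ^ (m + 1)) := by
        intro p hp
        simp only [mem_filter, mem_Ioc] at hp
        have hp1 : (2 : ℝ) ^ (m + 1) ≤ p := by exact_mod_cast hp.1.1.le
        have hp0 : (0 : ℝ) < p := lt_of_lt_of_le (by positivity) hp1
        have hlogp : ((m : ℝ) + 1) * log 2 ≤ log p := by
          have := log_le_log (by positivity) hp1
          rw [log_pow] at this
          exact_mod_cast this
        rw [inv_eq_one_div, div_le_div_iff₀ hp0 (by positivity), one_mul]
        gcongr
      have htheta := Chebyshev.theta_le_log4_mul_x (x := ((2 ^ (m + 1 + 1) : ℕ) : ℝ))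
        (by positivity)
      rw [Chebyshev.theta, Nat.floor_natCast] at htheta
      have hlog4 : log 4 = 2 * log 2 := by
        rw [show (4 : ℝ) = 2 ^ 2 by norm_num, log_pow]; norm_num
      calc _ ≤ _ := sum_le_sum hle
        _ = (∑ p ∈ Ioc (2 ^ (m + 1) : ℕ) (2 ^ (m + 1 + 1)) with p.Prime, log p) /
            (((m : ℝ) + 1) * log 2 * 2 ^ (m + 1)) := by rw [sum_div]
        _ ≤ (log 4 * ((2 ^ (m + 1 + 1) : ℕ) : ℝ)) / (((m : ℝ) + 1) * log 2 * 2 ^ (m + 1)) := by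
            gcongr
            refine le_trans (sum_le_sum_of_subset_of_nonneg
              (filter_subset_filter _ (Ioc_subset_Ioc_left (Nat.zero_le _)))
              fun p hp _ ↦ ?_) htheta
            exact log_natCast_nonneg p
        _ = _ := by
            rw [hlog4]; push_cast; field_simp; ring
    rw [hsplit]
    calc _ ≤ _ := le_add_of_nonneg_right (sum_nonneg fun p _ ↦ inv_nonneg.mpr (Nat.cast_nonneg p))
      _ = _ := sum_union_inter
      _ ≤ (1 + 4 * (harmonic m : ℝ)) + 4 / ((m : ℝ) + 1) := add_le_add ih hblock
      _ = _ := by push_cast; ring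

theorem two_pow_card_primeFactors_le {n : ℕ} (hn : n ≠ 0) : 2 ^ #n.primeFactors ≤ n :=
  calc 2 ^ #n.primeFactors = ∏ _p ∈ n.primeFactors, 2 := by simp
    _ ≤ ∏ p ∈ n.primeFactors, p :=
        prod_le_prod' fun p hp ↦ (Nat.prime_of_mem_primeFactors hp).two_le
    _ ≤ n := Nat.le_of_dvd (Nat.pos_of_ne_zero hn) (Nat.prod_primeFactors_dvd n)

theorem one_le_log_log {N : ℝ} (hN : 16 ≤ N) : 1 ≤ log (log N) ∧ 2.77 ≤ log N := by
  have h16 : log 16 = 4 * log 2 := by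
    rw [show (16 : ℝ) = 2 ^ 4 by norm_num, log_pow]; norm_num
  have h : 2.77 ≤ log N := by
    have := log_le_log (by norm_num) hN
    linarith [log_two_gt_d9]
  refine ⟨?_, h⟩
  rw [le_log_iff_exp_le (by linarith)]
  linarith [exp_one_lt_d9]

theorem sum_inv_primeFactors_le {N : ℝ} (hN : 16 ≤ N) {M : ℕ} (hM : M ≠ 0) (hMN : M ≤ 6 * N) :
    ∑ p ∈ M.primeFactors, (p : ℝ)⁻¹ ≤ 16 + 4 * log (log (log N)) := by
  obtain ⟨hL2, hL⟩ := one_le_log_log hN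
  set L := log N with hLdef
  set L2 := log L with hL2def
  have hL0 : 0 < L := by linarith
  have hlog2 : 0.69 < log 2 := by linarith [log_two_gt_d9]
  set m := ⌈L2 / log 2⌉₊ with hm
  have hm1 : (m : ℝ) ≤ 3 * L2 := by
    have h1 := (Nat.ceil_lt_add_one (show 0 ≤ L2 / log 2 by positivity)).le
    have h2 : L2 / log 2 ≤ 2 * L2 := by
      rw [div_le_iff₀ (by linarith)]; nlinarith
    linarith
  have hm0 : (0 : ℝ) < m := by
    have : 0 < m := Nat.ceil_pos.mpr (by positivity)
    exact_mod_cast this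
  have hLm : L ≤ 2 ^ (m + 1) := by
    have h1 : L2 ≤ m * log 2 := by
      have := Nat.le_ceil (L2 / log 2)
      rwa [div_le_iff₀ (by linarith)] at this
    have h2 : L ≤ 2 ^ m := by
      rw [← log_le_log_iff hL0 (by positivity), log_pow]
      exact h1
    exact h2.trans (pow_le_pow_right₀ (by norm_num) (by omega))
  have hcard : (#M.primeFactors : ℝ) ≤ 3 * L := by
    have h1 : (2 : ℝ) ^ #M.primeFactors ≤ M := by
      exact_mod_cast two_pow_card_primeFactors_le hM
    have h2 := log_le_log (by positivity) (h1.trans hMN)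
    rw [log_pow, log_mul (by norm_num) (by linarith), ← hLdef] at h2
    have h6 : log 6 ≤ 2 := by
      rw [show (6 : ℝ) = 2 * 3 by norm_num, log_mul (by norm_num) (by norm_num)]
      linarith [log_two_lt_d9, log_three_lt_d9]
    have h0 : (0 : ℝ) ≤ #M.primeFactors := by positivity
    nlinarith
  have hsmall : ∑ p ∈ M.primeFactors with p ≤ 2 ^ (m + 1), (p : ℝ)⁻¹ ≤
      1 + 4 * (harmonic m : ℝ) := by
    refine (sum_le_sum_of_subset_of_nonneg (fun p hp ↦ ?_) fun p _ _ ↦ by positivity).trans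
      (sum_inv_prime_le_two_pow m)
    simp only [mem_filter, mem_Ioc] at hp ⊢
    have := Nat.prime_of_mem_primeFactors hp.1
    exact ⟨⟨this.pos, hp.2⟩, this⟩
  have hlarge : ∑ p ∈ M.primeFactors with ¬ p ≤ 2 ^ (m + 1), (p : ℝ)⁻¹ ≤ 3 := by
    have h1 : ∀ p ∈ M.primeFactors.filter (¬ · ≤ 2 ^ (m + 1)), (p : ℝ)⁻¹ ≤ L⁻¹ := by
      intro p hp
      simp only [mem_filter, not_le] at hp
      have : (2 : ℝ) ^ (m + 1) ≤ p := by exact_mod_cast hp.2.le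
      exact inv_anti₀ hL0 (hLm.trans this)
    calc _ ≤ _ := sum_le_sum h1
      _ = (#(M.primeFactors.filter (¬ · ≤ 2 ^ (m + 1))) : ℝ) * L⁻¹ := by simp
      _ ≤ (3 * L) * L⁻¹ := by
          gcongr
          exact le_trans (by exact_mod_cast card_filter_le _ _) hcard
      _ = 3 := by field_simp
  have hharm := harmonic_le_one_add_log m
  have hlogm : log m ≤ 2 + log L2 := by
    have h1 := log_le_log hm0 hm1
    rw [log_mul (by norm_num) (by linarith)] at h1
    linarith [log_three_lt_d9]
  rw [← sum_filter_add_sum_filter_not M.primeFactors (· ≤ 2 ^ (m + 1))]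
  linarith

theorem sum_inv_sq_le_two (z : ℕ) : ∑ n ∈ Ioc 0 z, ((n : ℝ) ^ 2)⁻¹ ≤ 2 := by
  have h := sum_Ioo_inv_sq_le (α := ℝ) 0 (z + 1)
  have : Ioc 0 z = Ioo 0 (z + 1) := by ext; simp
  rw [this]
  simpa using h

theorem prod_one_add_le {N : ℝ} (hN : 16 ≤ N) {M : ℕ} (hM : M ≠ 0) (hMN : M ≤ 6 * N) (z : ℕ) :
    ∏ p ∈ Ioc 0 z with p.Prime, (1 + if p ∣ M then 18 / (p : ℝ) else 3 / (p : ℝ) ^ 2) ≤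
      exp 294 * log (log N) ^ 72 := by
  obtain ⟨hL2, -⟩ := one_le_log_log hN
  have hexp : ∏ p ∈ Ioc 0 z with p.Prime, (1 + if p ∣ M then 18 / (p : ℝ) else 3 / (p : ℝ) ^ 2) ≤
      exp (∑ p ∈ Ioc 0 z with p.Prime, if p ∣ M then 18 / (p : ℝ) else 3 / (p : ℝ) ^ 2) := by
    rw [exp_sum]
    refine prod_le_prod (fun p _ ↦ by split_ifs <;> positivity) fun p _ ↦ ?_
    rw [add_comm]
    exact add_one_le_exp _
  refine hexp.trans ?_
  have hE : exp 294 * log (log N) ^ 72 = exp (294 + 72 * log (log (log N))) := by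
    have h := exp_log (show 0 < log (log N) by linarith)
    rw [exp_add, mul_comm (72 : ℝ), exp_mul, h]
    norm_cast
  rw [hE, exp_le_exp]
  have h1 : ∑ p ∈ Ioc 0 z with p.Prime, (if p ∣ M then 18 / (p : ℝ) else 3 / (p : ℝ) ^ 2) ≤
      ∑ p ∈ Ioc 0 z with p.Prime, ((if p ∣ M then 18 / (p : ℝ) else 0) + 3 * ((p : ℝ) ^ 2)⁻¹) := by
    refine sum_le_sum fun p _ ↦ ?_
    split_ifs
    · exact le_add_of_nonneg_right (by positivity)
    · rw [zero_add, div_eq_mul_inv]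
  refine h1.trans ?_
  rw [sum_add_distrib, ← mul_sum]
  have h2 : ∑ p ∈ Ioc 0 z with p.Prime, ((p : ℝ) ^ 2)⁻¹ ≤ 2 :=
    (sum_le_sum_of_subset_of_nonneg (filter_subset _ _) fun _ _ _ ↦ by positivity).trans
      (sum_inv_sq_le_two z)
  have h3 : ∑ p ∈ Ioc 0 z with p.Prime, (if p ∣ M then 18 / (p : ℝ) else 0) ≤
      18 * ∑ p ∈ M.primeFactors, (p : ℝ)⁻¹ := by
    rw [← sum_filter, mul_sum]
    refine (sum_le_sum_of_subset_of_nonneg (t := M.primeFactors) (fun p hp ↦ ?_)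
      fun p _ _ ↦ by positivity).trans_eq (sum_congr rfl fun p _ ↦ div_eq_mul_inv _ _)
    simp only [mem_filter] at hp
    exact Nat.mem_primeFactors.mpr ⟨hp.1.2, hp.2, hM⟩
  have h4 := sum_inv_primeFactors_le hN hM hMN
  linarith

end PrimeReciprocals

section RootCount

open Finset

/-- The number of solutions in `ZMod d` of `r (a² + b² r²) = 0`. -/
noncomputable def rootCount (a b d : ℕ) : ℕ :=
  Nat.card {r : ZMod d // r * ((a : ZMod d) ^ 2 + (b : ZMod d) ^ 2 * r ^ 2) = 0}

theorem rootCount_mul_of_coprime (a b : ℕ) {m n : ℕ} (h : m.Coprime n) :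
    rootCount a b (m * n) = rootCount a b m * rootCount a b n := by
  rw [rootCount, rootCount, rootCount, ← Nat.card_prod]
  refine Nat.card_congr (Equiv.trans (Equiv.subtypeEquiv (ZMod.chineseRemainder h).toEquiv
    fun r ↦ ?_) Equiv.subtypeProdEquivProd)
  rw [← (ZMod.chineseRemainder h).map_eq_zero_iff, Prod.ext_iff]
  simp

theorem rootCount_one (a b : ℕ) : rootCount a b 1 = 1 := by
  have : Subsingleton (ZMod 1) := inferInstanceAs (Subsingleton (Fin 1))
  rw [rootCount, Nat.card_eq_one_iff_unique]
  exact ⟨inferInstance, ⟨⟨0, by simp⟩⟩⟩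

theorem rootCount_pos (a b : ℕ) {d : ℕ} (hd : d ≠ 0) : 0 < rootCount a b d := by
  have : NeZero d := ⟨hd⟩
  have : Nonempty {r : ZMod d // r * ((a : ZMod d) ^ 2 + (b : ZMod d) ^ 2 * r ^ 2) = 0} :=
    ⟨⟨0, by simp⟩⟩
  exact Nat.card_pos

theorem rootCount_le (a b : ℕ) {d : ℕ} (hd : d ≠ 0) : rootCount a b d ≤ d := by
  have : NeZero d := ⟨hd⟩
  exact (Finite.card_subtype_le _).trans_eq (Nat.card_zmod d)

theorem rootCount_eq_ncard (a b d : ℕ) : rootCount a b d =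
    {r : ZMod d | r * ((a : ZMod d) ^ 2 + (b : ZMod d) ^ 2 * r ^ 2) = 0}.ncard :=
  Nat.card_coe_set_eq _

theorem rootCount_le_three (a b : ℕ) {p : ℕ} (hp : p.Prime) (hb : ¬ p ∣ b) :
    rootCount a b p ≤ 3 := by
  have : Fact p.Prime := ⟨hp⟩
  have hb0 : (b : ZMod p) ≠ 0 := by rwa [Ne, ZMod.natCast_eq_zero_iff]
  rw [rootCount_eq_ncard]
  have key : ∃ r : ZMod p, {r : ZMod p | r * ((a : ZMod p) ^ 2 + (b : ZMod p) ^ 2 * r ^ 2) = 0} ⊆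
      ({0, r, -r} : Finset (ZMod p)) := by
    by_cases h : ∃ r : ZMod p, (a : ZMod p) ^ 2 + (b : ZMod p) ^ 2 * r ^ 2 = 0
    · obtain ⟨r, hr⟩ := h
      refine ⟨r, fun x hx ↦ ?_⟩
      rcases mul_eq_zero.mp hx with hx | hx
      · simp [hx]
      · have : (b : ZMod p) ^ 2 * ((x - r) * (x + r)) = 0 := by linear_combination hx - hr
        rcases mul_eq_zero.mp this with h | h
        · exact absurd h (pow_ne_zero 2 hb0)
        · rcases mul_eq_zero.mp h with h | h
          · simp [sub_eq_zero.mp h]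
          · simp [eq_neg_of_add_eq_zero_left h]
    · refine ⟨0, fun x hx ↦ ?_⟩
      rcases mul_eq_zero.mp hx with hx | hx
      · simp [hx]
      · exact absurd ⟨x, hx⟩ h
  obtain ⟨r, hr⟩ := key
  refine (Set.ncard_le_ncard hr (Finset.finite_toSet _)).trans ?_
  rw [Set.ncard_coe_finset]
  exact card_le_three

theorem three_le_rootCount {a b p : ℕ} (hp : p.Prime) (h4 : p % 4 = 1) (ha : ¬ p ∣ a)
    (hb : ¬ p ∣ b) : 3 ≤ rootCount a b p := by
  have : Fact p.Prime := ⟨hp⟩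
  have hb0 : (b : ZMod p) ≠ 0 := by rwa [Ne, ZMod.natCast_eq_zero_iff]
  have ha0 : (a : ZMod p) ≠ 0 := by rwa [Ne, ZMod.natCast_eq_zero_iff]
  have h20 : (2 : ZMod p) ≠ 0 := by
    have : ((2 : ℕ) : ZMod p) ≠ 0 := by
      rw [Ne, ZMod.natCast_eq_zero_iff, Nat.prime_dvd_prime_iff_eq hp Nat.prime_two]
      omega
    exact_mod_cast this
  obtain ⟨i, hi⟩ := ZMod.exists_sq_eq_neg_one_iff.mpr (show p % 4 ≠ 3 by omega)
  have hi0 : i ≠ 0 := by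
    rintro rfl
    simp at hi
  set r : ZMod p := a * i / b with hr
  have hr0 : r ≠ 0 := div_ne_zero (mul_ne_zero ha0 hi0) hb0
  have hroot : (a : ZMod p) ^ 2 + (b : ZMod p) ^ 2 * r ^ 2 = 0 := by
    rw [hr]
    field_simp
    linear_combination -(a : ZMod p) ^ 2 * hi
  have hrr : r ≠ -r := fun h ↦ mul_ne_zero h20 hr0 (by linear_combination h)
  have hcard : #({0, r, -r} : Finset (ZMod p)) = 3 :=
    card_eq_three.mpr ⟨0, r, -r, hr0.symm, (neg_ne_zero.mpr hr0).symm, hrr, rfl⟩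
  rw [rootCount_eq_ncard, ← hcard, ← Set.ncard_coe_finset]
  refine Set.ncard_le_ncard (fun x hx ↦ ?_) (Set.toFinite _)
  simp only [coe_insert, coe_singleton, Set.mem_insert_iff, Set.mem_singleton_iff] at hx
  rcases hx with rfl | rfl | rfl
  · simp
  · simp [hroot]
  · simp [hroot]

/-- The proportion of residue classes modulo `d` that solve `r (a² + b² r²) = 0`. -/
noncomputable def rootDensity (a b : ℕ) : ArithmeticFunction ℝ :=
  ⟨fun d ↦ rootCount a b d / d, by simp⟩

theorem rootDensity_apply (a b d : ℕ) : rootDensity a b d = rootCount a b d / d := rfl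

theorem rootDensity_isMultiplicative (a b : ℕ) : (rootDensity a b).IsMultiplicative := by
  refine ⟨by simp [rootDensity_apply, rootCount_one], fun {m n} h ↦ ?_⟩
  simp only [rootDensity_apply, rootCount_mul_of_coprime a b h]
  push_cast
  rw [mul_div_mul_comm]

theorem card_filter_dvd_range (a b : ℕ) {d : ℕ} (hd : d ≠ 0) :
    #{l ∈ range d | d ∣ l * (a ^ 2 + b ^ 2 * l ^ 2)} = rootCount a b d := by
  classical
  have : NeZero d := ⟨hd⟩
  rw [rootCount, Nat.card_eq_fintype_card, Fintype.card_subtype]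
  have hcast : ∀ l : ℕ, d ∣ l * (a ^ 2 + b ^ 2 * l ^ 2) ↔
      (l : ZMod d) * ((a : ZMod d) ^ 2 + (b : ZMod d) ^ 2 * (l : ZMod d) ^ 2) = 0 := by
    intro l
    rw [← ZMod.natCast_eq_zero_iff]
    push_cast
    rfl
  refine card_nbij' (fun l ↦ (l : ZMod d)) ZMod.val (fun l hl ↦ ?_) (fun r hr ↦ ?_)
    (fun l hl ↦ ?_) (fun r hr ↦ ?_)
  · simp only [coe_filter, mem_range, Set.mem_ofPred_eq, mem_univ, true_and] at hl ⊢
    exact (hcast l).mp hl.2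
  · simp only [coe_filter, mem_range, Set.mem_ofPred_eq, mem_univ, true_and] at hr ⊢
    refine ⟨ZMod.val_lt r, (hcast _).mpr ?_⟩
    rwa [ZMod.natCast_zmod_val]
  · simp only [coe_filter, mem_range, Set.mem_ofPred_eq] at hl
    exact ZMod.val_cast_of_lt hl.1
  · exact ZMod.natCast_zmod_val r

theorem card_filter_dvd_Ico_add (a b : ℕ) {d : ℕ} (hd : d ≠ 0) (m : ℕ) :
    #{l ∈ Ico m (m + d) | d ∣ l * (a ^ 2 + b ^ 2 * l ^ 2)} = rootCount a b d := by
  rw [Nat.filter_Ico_card_eq_of_periodic, Nat.count_eq_card_filter_range,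
    card_filter_dvd_range a b hd]
  intro l
  simp [← ZMod.natCast_eq_zero_iff]

theorem card_filter_dvd_Ico_mul (a b : ℕ) {d : ℕ} (hd : d ≠ 0) (k : ℕ) :
    #{l ∈ Ico 1 (1 + d * k) | d ∣ l * (a ^ 2 + b ^ 2 * l ^ 2)} = k * rootCount a b d := by
  induction k with
  | zero => simp
  | succ k ih =>
    rw [← Ico_union_Ico_eq_Ico (show 1 ≤ 1 + d * k by omega)
      (show 1 + d * k ≤ 1 + d * (k + 1) by rw [mul_add]; omega), filter_union,
      card_union_of_disjoint, ih, mul_add, mul_one, ← add_assoc, card_filter_dvd_Ico_add a b hd]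
    · ring
    · exact disjoint_filter_filter (Ico_disjoint_Ico_consecutive _ _ _)

theorem abs_card_filter_dvd_sub_le (a b : ℕ) {d : ℕ} (hd : d ≠ 0) (n : ℕ) :
    |(#{l ∈ Ico 1 (1 + n) | d ∣ l * (a ^ 2 + b ^ 2 * l ^ 2)} : ℝ) - rootDensity a b d * n| ≤ d := by
  have hd0 : (0 : ℝ) < d := by exact_mod_cast Nat.pos_of_ne_zero hd
  have hlow : d * (n / d) ≤ n := Nat.mul_div_le n d
  have hupp : n ≤ d * (n / d + 1) := (Nat.lt_mul_div_succ n (Nat.pos_of_ne_zero hd)).le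
  have h1 := card_le_card (filter_subset_filter (fun l ↦ d ∣ l * (a ^ 2 + b ^ 2 * l ^ 2))
    (Ico_subset_Ico_right (a := 1) (Nat.add_le_add_left hlow 1)))
  have h2 := card_le_card (filter_subset_filter (fun l ↦ d ∣ l * (a ^ 2 + b ^ 2 * l ^ 2))
    (Ico_subset_Ico_right (a := 1) (Nat.add_le_add_left hupp 1)))
  rw [card_filter_dvd_Ico_mul a b hd] at h1 h2
  set c := #{l ∈ Ico 1 (1 + n) | d ∣ l * (a ^ 2 + b ^ 2 * l ^ 2)}
  set k := n / d
  have hρ : (rootCount a b d : ℝ) ≤ d := by exact_mod_cast rootCount_le a b hd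
  have hρ0 : (0 : ℝ) ≤ rootCount a b d := by positivity
  rify at h1 h2 hlow hupp
  have h3 : rootDensity a b d * n = rootCount a b d * (n / d) := by
    rw [rootDensity_apply]; ring
  have h4 : (k : ℝ) ≤ n / d := by rw [le_div_iff₀ hd0]; linarith
  have h5 : (n : ℝ) / d ≤ k + 1 := by rw [div_le_iff₀ hd0]; linarith
  have h6 := mul_le_mul_of_nonneg_left h4 hρ0
  have h7 := mul_le_mul_of_nonneg_left h5 hρ0
  rw [h3, abs_le]
  constructor <;> linarith

end RootCount

section PolynomialSieve

open Finset

theorem strictMono_mul_add_sq {a : ℕ} (ha : 0 < a) (b : ℕ) :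
    StrictMono fun l : ℕ ↦ l * (a ^ 2 + b ^ 2 * l ^ 2) := fun x y h ↦
  Nat.mul_lt_mul_of_lt_of_le h (by gcongr) (by positivity)

/-- The product of the primes up to `z` that do not divide `M`. -/
def primesProd (M z : ℕ) : ℕ := ∏ p ∈ (Ioc 0 z).filter Nat.Prime with ¬ p ∣ M, p

theorem prime_dvd_primesProd {M z p : ℕ} (hp : p.Prime) (h : p ∣ primesProd M z) :
    p ≤ z ∧ ¬ p ∣ M := by
  obtain ⟨q, hq, hpq⟩ := (Prime.dvd_finsetProd_iff hp.prime _).mp h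
  simp only [mem_filter, mem_Ioc] at hq
  rw [(Nat.prime_dvd_prime_iff_eq hp hq.1.2).mp hpq]
  exact ⟨hq.1.1.2, hq.2⟩

theorem squarefree_primesProd (M z : ℕ) : Squarefree (primesProd M z) := by
  refine squarefree_prod_of_pairwise_isCoprime (fun p hp q hq hpq ↦ ?_) fun p hp ↦ ?_
  · simp only [coe_filter, mem_filter, Set.mem_ofPred_eq] at hp hq
    exact Nat.coprime_iff_isRelPrime.mp ((Nat.coprime_primes hp.1.2 hq.1.2).mpr hpq)
  · exact (mem_filter.mp (mem_filter.mp hp).1).2.prime.squarefree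

theorem five_le_of_not_dvd {a b p : ℕ} (hp : p.Prime) (h : ¬ p ∣ 6 * a * b) :
    5 ≤ p ∧ ¬ p ∣ a ∧ ¬ p ∣ b := by
  refine ⟨?_, fun h' ↦ h ?_, fun h' ↦ h (h'.mul_left _)⟩
  · by_contra! h5
    have := hp.two_le
    refine h (Dvd.dvd.mul_right (Dvd.dvd.mul_right ?_ a) b)
    interval_cases p
    · norm_num
    · norm_num
    · norm_num at hp
  · exact (h'.mul_left 6).mul_right b

/-- The sieve problem for the values of `l (a² + b² l²)` with `1 ≤ l ≤ n`, sifted by the primes up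
to `z` that do not divide `6 a b`. -/
noncomputable def polynomialSieve (a b n z : ℕ) : BoundingSieve where
  support := (Ico 1 (1 + n)).image fun l ↦ l * (a ^ 2 + b ^ 2 * l ^ 2)
  prodPrimes := primesProd (6 * a * b) z
  prodPrimes_squarefree := squarefree_primesProd _ _
  weights := fun _ ↦ 1
  weights_nonneg := fun _ ↦ zero_le_one
  totalMass := n
  nu := rootDensity a b
  nu_mult := rootDensity_isMultiplicative a b
  nu_pos_of_prime := fun p hp _ ↦ by
    have := rootCount_pos a b hp.ne_zero
    have := hp.pos
    rw [rootDensity_apply]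
    positivity
  nu_lt_one_of_prime := fun p hp h ↦ by
    obtain ⟨h5, -, hb⟩ := five_le_of_not_dvd hp (prime_dvd_primesProd hp h).2
    have h0 : (0 : ℝ) < p := by exact_mod_cast hp.pos
    rw [rootDensity_apply, div_lt_one h0, Nat.cast_lt]
    exact (rootCount_le_three a b hp hb).trans_lt (by omega)

theorem siftedSum_polynomialSieve {a : ℕ} (ha : 0 < a) (b n z : ℕ) :
    (polynomialSieve a b n z).siftedSum = #{l ∈ Ico 1 (1 + n) |
      (primesProd (6 * a * b) z).Coprime (l * (a ^ 2 + b ^ 2 * l ^ 2))} := by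
  rw [BoundingSieve.siftedSum]
  simp only [polynomialSieve]
  rw [sum_image fun x _ y _ h ↦ (strictMono_mul_add_sq ha b).injective h, card_filter]
  push_cast
  exact sum_congr rfl fun _ _ ↦ by congr

theorem abs_rem_polynomialSieve_le {a : ℕ} (ha : 0 < a) (b n z : ℕ) {d : ℕ} (hd : d ≠ 0) :
    |(polynomialSieve a b n z).rem d| ≤ d := by
  rw [BoundingSieve.rem, BoundingSieve.multSum]
  simp only [polynomialSieve]
  rw [sum_image fun x _ y _ h ↦ (strictMono_mul_add_sq ha b).injective h, ← sum_filter]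
  simpa using abs_card_filter_dvd_sub_le a b hd n

theorem selbergTerms_polynomialSieve_prime (a b n z : ℕ) {p : ℕ} (hp : p.Prime) :
    (polynomialSieve a b n z).selbergTerms p = rootCount a b p / (p - rootCount a b p) := by
  rw [BoundingSieve.selbergTerms_apply, hp.primeFactors, prod_singleton]
  simp only [polynomialSieve, rootDensity_apply]
  have h0 : (p : ℝ) ≠ 0 := by exact_mod_cast hp.ne_zero
  rw [one_sub_div h0, inv_div, div_mul_div_cancel₀ h0]

theorem sum_tauChi_le_selbergTerms_add (a b n z : ℕ) {p : ℕ} (hp : p.Prime)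
    (h : ¬ p ∣ 6 * a * b) (K : ℕ) : ∑ k ∈ range K, TauChi.tauChi (p ^ (k + 1)) ≤
      (polynomialSieve a b n z).selbergTerms p + 3 / (p : ℝ) ^ 2 := by
  obtain ⟨h5, ha, hb⟩ := five_le_of_not_dvd hp h
  rw [selbergTerms_polynomialSieve_prime a b n z hp]
  have hp5 : (5 : ℝ) ≤ p := by exact_mod_cast h5
  have hρ3 : (rootCount a b p : ℝ) ≤ 3 := by exact_mod_cast rootCount_le_three a b hp hb
  have hodd : p % 4 = 1 ∨ p % 4 = 3 := by
    have := hp.eq_two_or_odd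
    omega
  rcases hodd with h4 | h4
  · refine (TauChi.sum_tauChi_prime_pow_le_of_one_mod_four hp h4 K).trans ?_
    have hρ : (3 : ℝ) ≤ rootCount a b p := by exact_mod_cast three_le_rootCount hp h4 ha hb
    rw [le_antisymm hρ3 hρ]
    exact le_add_of_nonneg_right (by positivity)
  · refine (TauChi.sum_tauChi_prime_pow_le_of_three_mod_four hp h5 h4 K).trans ?_
    have hρ : (1 : ℝ) ≤ rootCount a b p := by exact_mod_cast rootCount_pos a b hp.ne_zero
    gcongr
    linarith

theorem sq_log_le_prod_mul_selbergSum (a b n z : ℕ) :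
    log (z + 1) ^ 2 / 6 ≤ (∏ p ∈ Ioc 0 z with p.Prime,
      (1 + if p ∣ 6 * a * b then 18 / (p : ℝ) else 3 / (p : ℝ) ^ 2)) *
        (polynomialSieve a b n z).selbergSum z := by
  refine (TauChi.sq_log_le_sum_tauChi z).trans (le_trans (le_of_eq ?_)
    (factoredSum_le_prod_mul_divisorSum TauChi.tauChi_nonneg TauChi.tauChi_isMultiplicative
      BoundingSieve.selbergTerms_isMultiplicative (fun p ↦ ¬ p ∣ 6 * a * b)
      (fun p ↦ if p ∣ 6 * a * b then 18 / (p : ℝ) else 3 / (p : ℝ) ^ 2)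
      (fun p ↦ by split_ifs <;> positivity) ((Ioc 0 z).filter Nat.Prime)
      (fun p hp ↦ (mem_filter.mp hp).2)
      (fun l hl ↦ (BoundingSieve.selbergTerms_pos (s := polynomialSieve a b n z) hl).le)
      (fun p hp h K ↦ ?_) (fun p hp h K ↦ ?_) z))
  · rw [factoredSum, filter_true_of_mem]
    intro m hm p hp
    simp only [mem_Ioc, mem_filter] at hm ⊢
    have hp' := Nat.prime_of_mem_primeFactors hp
    exact ⟨⟨hp'.pos, (Nat.le_of_mem_primeFactors hp).trans hm.2⟩, hp'⟩
  · rw [if_neg h]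
    exact sum_tauChi_le_selbergTerms_add a b n z (mem_filter.mp hp).2 h K
  · rw [if_pos (not_not.mp h)]
    exact TauChi.sum_tauChi_prime_pow_le_of_prime (mem_filter.mp hp).2 K

theorem card_coprime_primesProd_le {a : ℕ} (ha : 0 < a) (b n : ℕ) {z : ℕ} (hz : 1 ≤ z) :
    (#{l ∈ Ico 1 (1 + n) | (primesProd (6 * a * b) z).Coprime (l * (a ^ 2 + b ^ 2 * l ^ 2))} : ℝ) ≤
      6 * n * (∏ p ∈ Ioc 0 z with p.Prime,
        (1 + if p ∣ 6 * a * b then 18 / (p : ℝ) else 3 / (p : ℝ) ^ 2)) / log (z + 1) ^ 2 +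
          (z : ℝ) ^ 6 := by
  have hP : ∀ d, d ∣ (polynomialSieve a b n z).prodPrimes → d ≠ 0 := fun d hd ↦
    (BoundingSieve.squarefree_of_dvd_prodPrimes hd).ne_zero
  have hsieve := BoundingSieve.siftedSum_le_div_selbergSum_add_pow (s := polynomialSieve a b n z) hz
    (fun d hd ↦ by
      have hd0 : (0 : ℝ) < d := by exact_mod_cast Nat.pos_of_ne_zero (hP d hd)
      have hρ : (1 : ℝ) ≤ rootCount a b d := by exact_mod_cast rootCount_pos a b (hP d hd)
      change (rootDensity a b d)⁻¹ ≤ d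
      rw [rootDensity_apply, inv_div]
      exact div_le_self hd0.le hρ)
    (fun d hd ↦ abs_rem_polynomialSieve_le ha b n z (hP d hd))
  rw [siftedSum_polynomialSieve ha] at hsieve
  refine hsieve.trans (add_le_add_left ?_ _)
  have hS := BoundingSieve.selbergSum_pos (s := polynomialSieve a b n z) hz
  have hlog : 0 < log ((z : ℝ) + 1) := log_pos (by
    have : (1 : ℝ) ≤ z := by exact_mod_cast hz
    linarith)
  change (n : ℝ) / _ ≤ _
  rw [div_le_div_iff₀ hS (by positivity)]
  have h := mul_le_mul_of_nonneg_left (sq_log_le_prod_mul_selbergSum a b n z)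
    (show (0 : ℝ) ≤ 6 * n by positivity)
  linarith

end PolynomialSieve

section PrimePairs

open Finset

theorem ncard_primePairs_le (a : ℕ) {b : ℕ} (hb : 0 < b) (z : ℕ) (X y : ℝ) :
    {l : ℕ | l.Prime ∧ y < (l : ℝ) ∧ (l : ℝ) ≤ X ∧ Nat.Prime (a ^ 2 + b ^ 2 * l ^ 2)}.ncard ≤
      z + #{l ∈ Ico 1 (1 + ⌊X⌋₊) |
        (primesProd (6 * a * b) z).Coprime (l * (a ^ 2 + b ^ 2 * l ^ 2))} := by
  have hsub : {l : ℕ | l.Prime ∧ y < (l : ℝ) ∧ (l : ℝ) ≤ X ∧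
      Nat.Prime (a ^ 2 + b ^ 2 * l ^ 2)} ⊆ ↑(Ioc 0 z ∪ {l ∈ Ico 1 (1 + ⌊X⌋₊) |
        (primesProd (6 * a * b) z).Coprime (l * (a ^ 2 + b ^ 2 * l ^ 2))}) := by
    rintro l ⟨hl, -, hlX, hq⟩
    simp only [coe_union, coe_filter, coe_Ioc, Set.mem_union, Set.mem_Ioc, mem_Ico,
      Set.mem_ofPred_eq]
    rcases le_or_gt l z with hlz | hlz
    · exact Or.inl ⟨hl.pos, hlz⟩
    · refine Or.inr ⟨⟨hl.pos, by have := Nat.le_floor hlX; omega⟩, ?_⟩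
      have hlq : l ≤ a ^ 2 + b ^ 2 * l ^ 2 :=
        calc l ≤ l ^ 2 := Nat.le_self_pow two_ne_zero l
          _ ≤ b ^ 2 * l ^ 2 := Nat.le_mul_of_pos_left _ (by positivity)
          _ ≤ _ := Nat.le_add_left _ _
      have hcop : ∀ p : ℕ, p.Prime → z < p → (primesProd (6 * a * b) z).Coprime p :=
        fun p hp hpz ↦ ((Nat.Prime.coprime_iff_not_dvd hp).mpr fun h ↦
          (prime_dvd_primesProd hp h).1.not_gt hpz).symm
      exact (hcop l hl hlz).mul_right (hcop _ hq (hlz.trans_le hlq))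
  refine (Set.ncard_le_ncard hsub (finite_toSet _)).trans ?_
  rw [Set.ncard_coe_finset]
  exact (card_union_le _ _).trans (by simp)

theorem ncard_primePairs_le_of_one_lt {N : ℝ} (hN : 16 ≤ N) {a b : ℕ} (ha : 0 < a) (hb : 0 < b)
    {X : ℝ} (hX : 1 < X) (hXN : X = N / (a * b)) (y : ℝ) :
    ({l : ℕ | l.Prime ∧ y < (l : ℝ) ∧ (l : ℝ) ≤ X ∧
      Nat.Prime (a ^ 2 + b ^ 2 * l ^ 2)}.ncard : ℝ) ≤
        (864 * exp 294 + 288) * X * log (log N) ^ 72 / log X ^ 2 := by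
  obtain ⟨hL2, -⟩ := one_le_log_log hN
  have hX0 : 0 < X := by linarith
  set T : ℝ := X ^ (1 / 12 : ℝ) with hT
  have hT1 : 1 < T := one_lt_rpow hX (by norm_num)
  have hT12 : T ^ 12 = X := by
    rw [hT, ← rpow_natCast, ← rpow_mul hX0.le]
    norm_num
  have hlogX : log X = 12 * log T := by
    rw [← hT12, log_pow]
    norm_num
  have hlogT : 0 < log T := log_pos hT1
  set z := ⌊T⌋₊ with hz
  have hz1 : 1 ≤ z := Nat.le_floor (by simpa using hT1.le)
  have hzT : (z : ℝ) ≤ T := Nat.floor_le (by linarith)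
  have hlogz : log T ≤ log ((z : ℝ) + 1) := log_le_log (by linarith) (Nat.lt_floor_add_one T).le
  have hab : (0 : ℝ) < a * b := by positivity
  have hM : ((6 * a * b : ℕ) : ℝ) ≤ 6 * N := by
    rw [hXN, lt_div_iff₀ hab] at hX
    push_cast
    linarith
  have hB := prod_one_add_le hN (M := 6 * a * b) (by positivity) hM z
  have hcard := card_coprime_primesProd_le ha b ⌊X⌋₊ hz1
  set B := ∏ p ∈ Ioc 0 z with p.Prime,
    (1 + if p ∣ 6 * a * b then 18 / (p : ℝ) else 3 / (p : ℝ) ^ 2)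
  have hset := (Nat.cast_le (α := ℝ)).mpr (ncard_primePairs_le a hb z X y)
  rw [Nat.cast_add] at hset
  have hfloor : (⌊X⌋₊ : ℝ) ≤ X := Nat.floor_le hX0.le
  have hpow : 1 ≤ log (log N) ^ 72 := one_le_pow₀ hL2
  have hmain : 6 * (⌊X⌋₊ : ℝ) * B / log (z + 1) ^ 2 ≤
      6 * X * (exp 294 * log (log N) ^ 72) / log T ^ 2 := by
    gcongr
  have hT6 : T ^ 6 ≤ X * log (log N) ^ 72 / log T ^ 2 := by
    rw [le_div_iff₀ (by positivity), ← hT12]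
    have h1 : log T ≤ T ^ 3 := by
      have := log_le_sub_one_of_pos (show 0 < T by linarith)
      have := le_self_pow₀ hT1.le (show 3 ≠ 0 by norm_num)
      linarith
    calc T ^ 6 * log T ^ 2 ≤ T ^ 6 * (T ^ 3) ^ 2 := by gcongr
      _ = T ^ 12 * 1 := by ring
      _ ≤ _ := by gcongr
  have hzT6 : (z : ℝ) ≤ T ^ 6 := hzT.trans (le_self_pow₀ hT1.le (by norm_num))
  have hz6 : (z : ℝ) ^ 6 ≤ T ^ 6 := by gcongr
  calc _ ≤ 6 * X * (exp 294 * log (log N) ^ 72) / log T ^ 2 +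
        2 * (X * log (log N) ^ 72 / log T ^ 2) := by linarith
    _ = _ := by
      rw [hlogX]
      field_simp
      ring

end PrimePairs

theorem stmt_9 :
    ∃ C K : ℝ, 0 < C ∧ 0 ≤ K ∧ ∀ N : ℝ, 16 ≤ N → ∀ a b : ℕ, 0 < a → 0 < b →
      ({ℓ : ℕ | ℓ.Prime ∧ N ^ (1 / Real.log (Real.log N)) < (ℓ : ℝ) ∧
          (ℓ : ℝ) ≤ N / (a * b) ∧ Nat.Prime (a ^ 2 + b ^ 2 * ℓ ^ 2)}.ncard : ℝ)
        ≤ C * N * Real.log (Real.log N) ^ K / (a * b * Real.log N ^ 2) := by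
  refine ⟨864 * exp 294 + 288, (74 : ℕ), by positivity, by positivity, fun N hN a b ha hb ↦ ?_⟩
  rw [rpow_natCast]
  obtain ⟨hL2, hL⟩ := one_le_log_log hN
  have hN0 : 0 < N := by linarith
  have hL0 : 0 < log N := by linarith
  have hL20 : 0 < log (log N) := by linarith
  have hab : (0 : ℝ) < a * b := by positivity
  rcases le_or_gt (N / (a * b)) (N ^ (1 / log (log N))) with hle | hgt
  · have hempty : {ℓ : ℕ | ℓ.Prime ∧ N ^ (1 / log (log N)) < (ℓ : ℝ) ∧
        (ℓ : ℝ) ≤ N / (a * b) ∧ Nat.Prime (a ^ 2 + b ^ 2 * ℓ ^ 2)} = ∅ :=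
      Set.eq_empty_of_forall_notMem fun ℓ h ↦ (h.2.1.trans_le (h.2.2.1.trans hle)).false
    rw [hempty, Set.ncard_empty, Nat.cast_zero]
    positivity
  · have hlog : log N / log (log N) ≤ log (N / (a * b)) := by
      have := log_le_log (by positivity) hgt.le
      rwa [log_rpow hN0, one_div_mul_eq_div] at this
    have hX1 : 1 < N / (a * b) :=
      (one_lt_rpow (by linarith) (by positivity)).trans hgt
    refine (ncard_primePairs_le_of_one_lt hN ha hb hX1 rfl _).trans ?_
    calc _ ≤ (864 * exp 294 + 288) * (N / (a * b)) * log (log N) ^ 72 /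
          (log N / log (log N)) ^ 2 := by gcongr
      _ = _ := by
        field_simp
end
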